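/- arXiv:2012.06794 — 3 statements merged into one kernel-verified Lean document; each statement's English description precedes it below -/
import Mathlib

section
/- For every cardinal κ, the cardinality of the cone group 𝒞_κ equals 1 if κ = 0, and equals κ^{ℵ₀} if κ ≥ 1. -/
noncomputable section

namespace GriffithsWords

/-- A (transfinite) word over the alphabet `𝒜 = {a_{α,n}^{±1} : α ∈ ι, n ∈ ℕ}`.
Since the finiteness condition forces the domain of a word to be a countable linear order,
and every countable linear order embeds in `ℚ`, we realize words (up to letter-preserving
order isomorphism) as functions on subsets of `ℚ`.  A letter is recorded as a triple
`(α, n, sign)`, standing for `a_{α,n}` if `sign = true` and for `a_{α,n}⁻¹` otherwise. -/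
structure Word (ι : Type) : Type where
  /-- The (totally ordered) domain `W̄` of the word. -/
  dom : Set ℚ
  /-- The letter occupying each position (values outside `dom` are irrelevant). -/
  letter : ℚ → ι × ℕ × Bool
  /-- For each `N` only finitely many positions carry a letter with second subscript `≤ N`. -/
  finite_le : ∀ N : ℕ, {q | q ∈ dom ∧ (letter q).2.1 ≤ N}.Finite

namespace Word

variable {ι : Type}

/-- The positions of `W` carrying a letter with second subscript `≤ N`, listed in
increasing order. -/
def truncList (W : Word ι) (N : ℕ) : List ℚ :=
  (W.finite_le N).toFinset.sort (· ≤ ·)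

/-- `p_N(W)`: the finite truncation of `W` at level `N`, as an element of the free group
on the positive letters. -/
def trunc (W : Word ι) (N : ℕ) : FreeGroup (ι × ℕ) :=
  FreeGroup.mk ((W.truncList N).map fun q =>
    (((W.letter q).1, (W.letter q).2.1), (W.letter q).2.2))

/-- The family of all finite truncations of a word; two words are `∼`-equivalent
precisely when their `Phi`-values agree. -/
def Phi (W : Word ι) : (N : ℕ) → FreeGroup (ι × ℕ) := fun N => W.trunc N

/-- `W ∼ U`: all finite truncations agree in the free group. -/
def Equiv (W U : Word ι) : Prop := ∀ N, W.trunc N = U.trunc N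

/-- `W ∼ E`: all finite truncations are freely trivial. -/
def SimE (W : Word ι) : Prop := ∀ N, W.trunc N = 1

/-- `W ≡ U`: there is an order isomorphism of the domains carrying the letters of `W` to
those of `U`. -/
def OrdEquiv (W U : Word ι) : Prop :=
  ∃ e : W.dom ≃o U.dom, ∀ q : W.dom, U.letter (e q) = W.letter (q : ℚ)

/-- The restriction `W ↾ I` of a word to a subset of its domain. -/
def restrict (W : Word ι) (I : Set ℚ) : Word ι where
  dom := W.dom ∩ I
  letter := W.letter
  finite_le := fun N => (W.finite_le N).subset (by intro q hq; exact ⟨hq.1.1, hq.2⟩)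

/-- `I` is an interval (order-convex subset) of the domain of `W`. -/
def IsIntervalIn (W : Word ι) (I : Set ℚ) : Prop :=
  I ⊆ W.dom ∧ ∀ a ∈ I, ∀ c ∈ I, ∀ b ∈ W.dom, a ≤ b → b ≤ c → b ∈ I

/-- A word is *reduced* if in any decomposition `W ≡ W₀W₁W₂` with `W₁ ∼ E` the middle
word `W₁` is empty; equivalently, the restriction of `W` to any nonempty interval of its
domain is not `∼ E`. -/
def Reduced (W : Word ι) : Prop :=
  ∀ I : Set ℚ, W.IsIntervalIn I → (W.restrict I).SimE → I = ∅

/-- A word is `α`-pure if all of its letters have first subscript `α`; it is *pure* if it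
is `α`-pure for some `α`. -/
def IsPure (W : Word ι) : Prop :=
  ∃ α : ι, ∀ q ∈ W.dom, (W.letter q).1 = α

end Word

open Word

/-- The group of (`∼`-classes of) words over `𝒜_ι`, realized concretely: it is the subgroup
of `∏_N FreeGroup (ι × ℕ)` generated by the truncation data `Φ(W)` of words `W` (this set
of generators is already closed under the group operations, since words can be concatenated
and inverted; the resulting group is `𝒲_ι/∼ ≅ Red_ι`). -/
def wordGroup (ι : Type) : Subgroup ((N : ℕ) → FreeGroup (ι × ℕ)) :=
  Subgroup.closure (Set.range (Phi (ι := ι)))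

lemma Phi_mem_wordGroup {ι : Type} (W : Word ι) : W.Phi ∈ wordGroup ι :=
  Subgroup.subset_closure ⟨W, rfl⟩

/-- The elements of the word group represented by pure reduced words. -/
def pureClasses (ι : Type) : Set (wordGroup ι) :=
  {g | ∃ W : Word ι, W.Reduced ∧ W.IsPure ∧ W.Phi = (g : (N : ℕ) → FreeGroup (ι × ℕ))}

/-- The cone group `𝒞_ι`: the quotient of the group of reduced words by the normal closure
of the set of pure reduced words. -/
def ConeGroup (ι : Type) : Type :=
  wordGroup ι ⧸ Subgroup.normalClosure (pureClasses ι)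

instance (ι : Type) : Group (ConeGroup ι) := by
  unfold ConeGroup; infer_instance

/-- `[[W]]`: the class of a word in the cone group. -/
def coneClass {ι : Type} (W : Word ι) : ConeGroup ι :=
  QuotientGroup.mk ⟨W.Phi, Phi_mem_wordGroup W⟩

end GriffithsWords

namespace ConeCard

open GriffithsWords GriffithsWords.Word

variable {ι : Type}

/-! ### Sorted lists and truncations -/

/-- A sorted duplicate-free list is the sort of its underlying finset. -/
lemma sort_eq_of {l : List ℚ} (hl : l.Pairwise (· < ·)) (F : Finset ℚ)
    (h : ∀ q, q ∈ F ↔ q ∈ l) : F.sort (· ≤ ·) = l := by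
  have hnd : l.Nodup := hl.imp (fun h => ne_of_lt h)
  have hF : F = l.toFinset := by ext q; simp [h]
  subst hF
  exact (List.toFinset_sort (· ≤ ·) hnd).2 (hl.imp (fun h => le_of_lt h))

/-- The element of the free group spelled by the letters at positions in `F`. -/
def tr (f : ℚ → ι × ℕ × Bool) (F : Finset ℚ) : FreeGroup (ι × ℕ) :=
  FreeGroup.mk ((F.sort (· ≤ ·)).map fun q => (((f q).1, (f q).2.1), (f q).2.2))

lemma tr_union (f : ℚ → ι × ℕ × Bool) (A B : Finset ℚ) (h : ∀ a ∈ A, ∀ b ∈ B, a < b) :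
    tr f (A ∪ B) = tr f A * tr f B := by
  unfold tr
  rw [FreeGroup.mul_mk, ← List.map_append]
  congr 2
  apply sort_eq_of
  · rw [List.pairwise_append]
    refine ⟨(Finset.sortedLT_sort A).pairwise, (Finset.sortedLT_sort B).pairwise, ?_⟩
    intro a ha b hb
    exact h a (by simpa using ha) b (by simpa using hb)
  · simp

lemma trunc_eq_tr (W : Word ι) (N : ℕ) :
    W.trunc N = tr W.letter (W.finite_le N).toFinset := rfl

lemma trunc_restrict (W : Word ι) (S : Set ℚ) [DecidablePred (· ∈ S)] (N : ℕ) :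
    (W.restrict S).trunc N = tr W.letter ((W.finite_le N).toFinset.filter (· ∈ S)) := by
  rw [trunc_eq_tr]
  show tr W.letter _ = _
  congr 1
  ext q
  simp [Word.restrict]
  tauto

lemma trunc_remove (W : Word ι) (I : Set ℚ) (hI : W.IsIntervalIn I)
    (hE : (W.restrict I).SimE) (N : ℕ) : (W.restrict Iᶜ).trunc N = W.trunc N := by
  classical
  have h1 := hE N
  rw [trunc_restrict] at h1
  rw [trunc_restrict, trunc_eq_tr]
  set F := (W.finite_le N).toFinset with hF
  have hFd : ∀ q ∈ F, q ∈ W.dom := by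
    intro q hq; simp [hF] at hq; exact hq.1
  set A := F.filter (fun q => q ∉ I ∧ ∀ i ∈ I, q < i) with hA
  set B := F.filter (fun q => q ∉ I ∧ ∃ i ∈ I, i < q) with hB
  set J := F.filter (· ∈ I) with hJ
  have hAJ : ∀ a ∈ A, ∀ b ∈ J, a < b := by
    intro a ha b hb
    simp only [hA, hJ, Finset.mem_filter] at ha hb
    exact ha.2.2 b hb.2
  have hJB : ∀ a ∈ J, ∀ b ∈ B, a < b := by
    intro a ha b hb
    simp only [hB, hJ, Finset.mem_filter] at ha hb
    obtain ⟨hbF, hbI, i, hi, hib⟩ := hb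
    by_contra hcon
    exact hbI (hI.2 i hi a ha.2 b (hFd b hbF) hib.le (not_lt.1 hcon))
  have hAB : ∀ a ∈ A, ∀ b ∈ B, a < b := by
    intro a ha b hb
    simp only [hB, hA, Finset.mem_filter] at ha hb
    obtain ⟨hbF, hbI, i, hi, hib⟩ := hb
    exact (ha.2.2 i hi).trans hib
  have e1 : F = A ∪ (J ∪ B) := by
    ext q
    simp only [hA, hB, hJ, Finset.mem_union, Finset.mem_filter]
    constructor
    · intro hq
      by_cases hqI : q ∈ I
      · exact Or.inr (Or.inl ⟨hq, hqI⟩)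
      · by_cases h : ∀ i ∈ I, q < i
        · exact Or.inl ⟨hq, hqI, h⟩
        · push Not at h
          obtain ⟨i, hi, hiq⟩ := h
          exact Or.inr (Or.inr ⟨hq, hqI, i, hi, lt_of_le_of_ne hiq (by rintro rfl; exact hqI hi)⟩)
    · tauto
  have e2 : F.filter (· ∈ Iᶜ) = A ∪ B := by
    ext q
    simp only [hA, hB, Finset.mem_union, Finset.mem_filter, Set.mem_compl_iff]
    constructor
    · rintro ⟨hq, hqI⟩
      by_cases h : ∀ i ∈ I, q < i
      · exact Or.inl ⟨hq, hqI, h⟩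
      · push Not at h
        obtain ⟨i, hi, hiq⟩ := h
        exact Or.inr ⟨hq, hqI, i, hi, lt_of_le_of_ne hiq (by rintro rfl; exact hqI hi)⟩
    · tauto
  rw [e2, tr_union _ _ _ hAB]
  conv_rhs => rw [e1]
  rw [tr_union, tr_union _ _ _ hJB, h1, one_mul]
  intro a ha b hb
  rcases Finset.mem_union.1 hb with hb | hb
  · exact hAJ a ha b hb
  · exact hAB a ha b hb

/-- On a finite set, a nonempty chain of sets has a member agreeing with its intersection. -/
lemma chain_finite (c : Set (Set ℚ)) (hc : IsChain (· ⊆ ·) c) (hne : c.Nonempty)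
    (F : Finset ℚ) : ∃ S ∈ c, ∀ q ∈ F, q ∈ S → q ∈ ⋂₀ c := by
  classical
  induction F using Finset.induction_on with
  | empty => obtain ⟨S, hS⟩ := hne; exact ⟨S, hS, by simp⟩
  | insert a F ha ih =>
    obtain ⟨S, hS, h⟩ := ih
    by_cases haI : a ∈ ⋂₀ c
    · refine ⟨S, hS, ?_⟩
      intro q hq hqS
      rcases Finset.mem_insert.1 hq with rfl | hq
      · exact haI
      · exact h q hq hqS
    · simp only [Set.mem_sInter, not_forall] at haI
      obtain ⟨T, hT, haT⟩ := haI
      rcases hc.total hS hT with hST | hTS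
      · refine ⟨S, hS, ?_⟩
        intro q hq hqS
        rcases Finset.mem_insert.1 hq with rfl | hq
        · exact absurd (hST hqS) haT
        · exact h q hq hqS
      · refine ⟨T, hT, ?_⟩
        intro q hq hqT
        rcases Finset.mem_insert.1 hq with rfl | hq
        · exact absurd hqT haT
        · exact h q hq (hTS hqT)

/-- Every word is equivalent to a reduced restriction of itself. -/
lemma exists_reduced (W : Word ι) :
    ∃ S : Set ℚ, (W.restrict S).Reduced ∧ (W.restrict S).Phi = W.Phi := by
  classical
  obtain ⟨S, -, hS⟩ := zorn_superset_nonempty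
    {S : Set ℚ | (W.restrict S).Phi = W.Phi} (by
      intro c hcS hc hne
      refine ⟨⋂₀ c, ?_, fun s hs => Set.sInter_subset_of_mem hs⟩
      funext N
      obtain ⟨S, hS, h⟩ := chain_finite c hc hne (W.finite_le N).toFinset
      rw [← congrFun (hcS hS) N]
      show (W.restrict (⋂₀ c)).trunc N = (W.restrict S).trunc N
      rw [trunc_restrict, trunc_restrict]
      congr 1
      ext q
      simp only [Finset.mem_filter]
      exact ⟨fun hq => ⟨hq.1, hq.2 S hS⟩, fun hq => ⟨hq.1, h q hq.1 hq.2⟩⟩)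
    Set.univ (by
      funext N
      show (W.restrict Set.univ).trunc N = W.trunc N
      rw [trunc_restrict, trunc_eq_tr]
      simp)
  refine ⟨S, ?_, hS.prop⟩
  intro I hI hE
  have key : (W.restrict (S ∩ Iᶜ)).Phi = W.Phi := by
    rw [← hS.prop]
    funext N
    have := trunc_remove (W.restrict S) I hI hE N
    show (W.restrict (S ∩ Iᶜ)).trunc N = (W.restrict S).trunc N
    rw [← this, trunc_restrict, trunc_restrict]
    show _ = tr W.letter _
    congr 1
    ext q
    simp [Word.restrict]
    tauto
  have hle := hS.le_of_le key Set.inter_subset_left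
  rw [Set.eq_empty_iff_forall_notMem]
  intro q hq
  exact (hle (hI.1 hq).2).2 hq

lemma pure_mem (W : Word ι) (hW : W.IsPure) :
    (⟨W.Phi, Phi_mem_wordGroup W⟩ : wordGroup ι) ∈ pureClasses ι := by
  obtain ⟨S, hS, h⟩ := exists_reduced W
  obtain ⟨α, hα⟩ := hW
  exact ⟨W.restrict S, hS, ⟨α, fun q hq => hα q hq.1⟩, h⟩

lemma subsingleton_cone [Subsingleton ι] : Subsingleton (ConeGroup ι) := by
  have htop : Subgroup.normalClosure (pureClasses ι) = ⊤ := by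
    rw [eq_top_iff]
    rintro ⟨g, hg⟩ -
    suffices h : wordGroup ι ≤ (Subgroup.normalClosure (pureClasses ι)).map (wordGroup ι).subtype by
      obtain ⟨x, hx, hxg⟩ := h hg
      have : x = ⟨g, hg⟩ := Subtype.ext hxg
      exact this ▸ hx
    refine (Subgroup.closure_le _).2 ?_
    rintro _ ⟨W, rfl⟩
    refine ⟨⟨W.Phi, Phi_mem_wordGroup W⟩, Subgroup.subset_normalClosure ?_, rfl⟩
    exact pure_mem W ⟨(W.letter 0).1, fun q _ => Subsingleton.elim _ _⟩
  unfold ConeGroup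
  rw [htop]
  exact QuotientGroup.subsingleton_quotient_top

/-! ### A Heisenberg-type group -/

/-- Triples `(x, y, M)` with two vectors and one matrix. -/
@[ext] structure Heis (m : ℕ) where
  /-- first vector -/
  x : Fin m → ℚ
  /-- second vector -/
  y : Fin m → ℚ
  /-- central part -/
  M : Matrix (Fin m) (Fin m) ℚ

namespace Heis

variable {m : ℕ}

instance : Mul (Heis m) := ⟨fun a b => ⟨a.x + b.x, a.y + b.y, a.M + b.M + Matrix.vecMulVec a.x b.y⟩⟩
instance : One (Heis m) := ⟨⟨0, 0, 0⟩⟩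
instance : Inv (Heis m) := ⟨fun a => ⟨-a.x, -a.y, -a.M + Matrix.vecMulVec a.x a.y⟩⟩

@[simp] lemma mul_x (a b : Heis m) : (a * b).x = a.x + b.x := rfl
@[simp] lemma mul_y (a b : Heis m) : (a * b).y = a.y + b.y := rfl
@[simp] lemma mul_M (a b : Heis m) : (a * b).M = a.M + b.M + Matrix.vecMulVec a.x b.y := rfl
@[simp] lemma one_x : (1 : Heis m).x = 0 := rfl
@[simp] lemma one_y : (1 : Heis m).y = 0 := rfl
@[simp] lemma one_M : (1 : Heis m).M = 0 := rfl
@[simp] lemma inv_x (a : Heis m) : (a⁻¹).x = -a.x := rfl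
@[simp] lemma inv_y (a : Heis m) : (a⁻¹).y = -a.y := rfl
@[simp] lemma inv_M (a : Heis m) : (a⁻¹).M = -a.M + Matrix.vecMulVec a.x a.y := rfl

instance : Group (Heis m) := Group.ofLeftAxioms
  (by
    intro a b c
    ext <;> simp [Matrix.vecMulVec_apply] <;> ring)
  (by intro a; ext <;> simp [Matrix.vecMulVec_apply])
  (by intro a; ext <;> simp [Matrix.vecMulVec_apply])

end Heis

lemma rank_add_le {m : ℕ} (A B : Matrix (Fin m) (Fin m) ℚ) : (A + B).rank ≤ A.rank + B.rank := by
  unfold Matrix.rank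
  rw [Matrix.mulVecLin_add]
  refine (Submodule.finrank_mono (LinearMap.range_add_le _ _)).trans ?_
  exact Submodule.finrank_add_le_finrank_add_finrank _ _

lemma rank_neg_le {m : ℕ} (A : Matrix (Fin m) (Fin m) ℚ) : (-A).rank ≤ A.rank := by
  have : -A = (-1) * A := by simp
  rw [this]
  exact Matrix.rank_mul_le_right _ _

lemma Heis.rank_mul {m : ℕ} (a b : Heis m) : (a * b).M.rank ≤ a.M.rank + b.M.rank + 1 := by
  rw [Heis.mul_M]
  have h1 := rank_add_le (a.M + b.M) (Matrix.vecMulVec a.x b.y)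
  have h2 := rank_add_le a.M b.M
  have h3 := Matrix.rank_vecMulVec_le a.x b.y
  omega

lemma Heis.rank_inv {m : ℕ} (a : Heis m) : (a⁻¹).M.rank ≤ a.M.rank + 1 := by
  rw [Heis.inv_M]
  have h1 := rank_add_le (-a.M) (Matrix.vecMulVec a.x a.y)
  have h2 := rank_neg_le a.M
  have h3 := Matrix.rank_vecMulVec_le a.x a.y
  omega

lemma Heis.rank_conj {m : ℕ} (g a : Heis m) : (g * a * g⁻¹).M.rank ≤ a.M.rank + 2 := by
  have e : (g * a * g⁻¹).M
      = a.M + Matrix.vecMulVec g.x a.y + Matrix.vecMulVec (-a.x) g.y := by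
    ext i j
    simp [Matrix.vecMulVec_apply]
    ring
  rw [e]
  have h1 := rank_add_le (a.M + Matrix.vecMulVec g.x a.y) (Matrix.vecMulVec (-a.x) g.y)
  have h2 := rank_add_le a.M (Matrix.vecMulVec g.x a.y)
  have h3 := Matrix.rank_vecMulVec_le g.x a.y
  have h4 := Matrix.rank_vecMulVec_le (-a.x) g.y
  omega

/-! ### The homomorphisms -/

open Classical in
/-- The image of a letter. -/
def letterIm (β : ι) (c : ι → ℕ → ℚ) (m : ℕ) (p : ι × ℕ) : Heis m :=
  ⟨fun i => if i.val = p.2 then c p.1 p.2 else 0,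
   fun i => if i.val = p.2 then (if p.1 = β then 1 else 0) else 0, 0⟩

/-- The level `N` homomorphism. -/
def hm (β : ι) (c : ι → ℕ → ℚ) (m : ℕ) : FreeGroup (ι × ℕ) →* Heis m :=
  FreeGroup.lift (letterIm β c m)

/-- Subgroup of elements whose central parts have uniformly bounded rank. -/
def bddSub (β : ι) (c : ι → ℕ → ℚ) : Subgroup (wordGroup ι) where
  carrier := {g | ∃ k : ℕ, ∀ N, (hm β c (N + 1) (g.1 N)).M.rank ≤ k}
  one_mem' := ⟨0, fun N => by simp⟩
  mul_mem' := by
    rintro a b ⟨k, hk⟩ ⟨l, hl⟩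
    refine ⟨k + l + 1, fun N => ?_⟩
    have := Heis.rank_mul (hm β c (N + 1) (a.1 N)) (hm β c (N + 1) (b.1 N))
    have h1 := hk N
    have h2 := hl N
    simp only [Subgroup.coe_mul, Pi.mul_apply, map_mul]
    omega
  inv_mem' := by
    rintro a ⟨k, hk⟩
    refine ⟨k + 1, fun N => ?_⟩
    have := Heis.rank_inv (hm β c (N + 1) (a.1 N))
    have h1 := hk N
    simp only [Subgroup.coe_inv, Pi.inv_apply, map_inv]
    omega

instance (β : ι) (c : ι → ℕ → ℚ) : (bddSub β c).Normal where
  conj_mem := by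
    rintro a ⟨k, hk⟩ g
    refine ⟨k + 2, fun N => ?_⟩
    have := Heis.rank_conj (hm β c (N + 1) (g.1 N)) (hm β c (N + 1) (a.1 N))
    have h1 := hk N
    simp only [Subgroup.coe_mul, Subgroup.coe_inv, Pi.mul_apply, Pi.inv_apply, map_mul, map_inv]
    omega

/-- The subgroup `x = 0, M = 0`. -/
def subY (m : ℕ) : Subgroup (Heis m) where
  carrier := {a | a.x = 0 ∧ a.M = 0}
  one_mem' := by simp
  mul_mem' := by
    rintro a b ⟨h1, h2⟩ ⟨h3, h4⟩
    simp [h1, h2, h3, h4]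
  inv_mem' := by
    rintro a ⟨h1, h2⟩
    simp [h1, h2]

/-- The subgroup `y = 0, M = 0`. -/
def subX (m : ℕ) : Subgroup (Heis m) where
  carrier := {a | a.y = 0 ∧ a.M = 0}
  one_mem' := by simp
  mul_mem' := by
    rintro a b ⟨h1, h2⟩ ⟨h3, h4⟩
    simp [h1, h2, h3, h4]
  inv_mem' := by
    rintro a ⟨h1, h2⟩
    simp [h1, h2]

lemma lift_mem {G : Type*} [Group G] (f : ι × ℕ → G) (H : Subgroup G)
    (L : List ((ι × ℕ) × Bool)) (h : ∀ p ∈ L, f p.1 ∈ H) : FreeGroup.lift f (FreeGroup.mk L) ∈ H := by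
  rw [FreeGroup.lift_mk]
  apply Subgroup.list_prod_mem
  intro g hg
  obtain ⟨p, hp, rfl⟩ := List.mem_map.1 hg
  cases p.2
  · exact H.inv_mem (h p hp)
  · exact h p hp

lemma pure_bdd (β : ι) (c : ι → ℕ → ℚ) (hc : ∀ n, c β n = 0) :
    pureClasses ι ⊆ (bddSub β c : Set (wordGroup ι)) := by
  rintro g ⟨W, -, ⟨α, hα⟩, hg⟩
  refine ⟨0, fun N => ?_⟩
  suffices h : (hm β c (N + 1) (g.1 N)).M = 0 by rw [h]; simp
  rw [← hg]
  show (FreeGroup.lift (letterIm β c (N + 1)) (FreeGroup.mk _)).M = 0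
  have hL : ∀ p ∈ (W.truncList N).map fun q =>
    (((W.letter q).1, (W.letter q).2.1), (W.letter q).2.2), p.1.1 = α := by
    intro p hp
    obtain ⟨q, hq, rfl⟩ := List.mem_map.1 hp
    simp [Word.truncList] at hq
    exact hα q hq.1
  by_cases hαβ : α = β
  · refine (lift_mem _ (subY (N + 1)) _ ?_).2
    intro p hp
    refine ⟨?_, rfl⟩
    funext i
    simp [letterIm, hL p hp, hαβ, hc]
  · refine (lift_mem _ (subX (N + 1)) _ ?_).2
    intro p hp
    refine ⟨?_, rfl⟩
    funext i
    simp [letterIm, hL p hp, hαβ]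

/-! ### The words -/

/-- The letter at position `k` of the word `∏ₙ [a_{σ n, n}, a_{β, n}]`. -/
def wl (β : ι) (σ : ℕ → ι) (k : ℕ) : ι × ℕ × Bool :=
  (if k % 2 = 0 then σ (k / 4) else β, k / 4, decide (k % 4 < 2))

/-- The word `∏ₙ [a_{σ n, n}, a_{β, n}]`. -/
def ww (β : ι) (σ : ℕ → ι) : Word ι where
  dom := Set.range (fun k : ℕ => (k : ℚ))
  letter := fun q => wl β σ q.num.toNat
  finite_le := by
    intro N
    refine ((Finset.range (4 * (N + 1))).finite_toSet.image (fun k : ℕ => (k : ℚ))).subset ?_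
    rintro _ ⟨⟨k, rfl⟩, h⟩
    refine ⟨k, ?_, rfl⟩
    simp [wl] at h ⊢
    omega

lemma ww_trunc (β : ι) (σ : ℕ → ι) (N : ℕ) :
    (ww β σ).trunc N = FreeGroup.mk ((List.range (4 * (N + 1))).map fun k =>
      (((wl β σ k).1, (wl β σ k).2.1), (wl β σ k).2.2)) := by
  have : (ww β σ).truncList N = (List.range (4 * (N + 1))).map (fun k : ℕ => (k : ℚ)) := by
    apply sort_eq_of
    · rw [List.pairwise_map]
      exact List.pairwise_lt_range.imp (fun h => by exact_mod_cast h)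
    · intro q
      simp only [Set.Finite.mem_toFinset, Set.mem_setOf_eq, List.mem_map, List.mem_range]
      constructor
      · rintro ⟨⟨k, rfl⟩, h⟩
        refine ⟨k, ?_, rfl⟩
        simp [ww, wl] at h
        omega
      · rintro ⟨k, hk, rfl⟩
        refine ⟨⟨k, rfl⟩, ?_⟩
        simp [ww, wl]
        omega
  unfold Word.trunc
  rw [this, List.map_map]
  congr 1

lemma comm_im (β α : ι) (c : ι → ℕ → ℚ) (hc : ∀ n, c β n = 0) (m n : ℕ) :
    letterIm β c m (α, n) * letterIm β c m (β, n) * (letterIm β c m (α, n))⁻¹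
      * (letterIm β c m (β, n))⁻¹
    = ⟨0, 0, Matrix.diagonal fun i => if i.val = n then c α n else 0⟩ := by
  ext i j
  · simp [letterIm]
  · simp [letterIm]
  · simp only [letterIm, Heis.mul_M, Heis.mul_x, Heis.mul_y, Heis.inv_M, Heis.inv_x, Heis.inv_y,
      Matrix.add_apply, Matrix.neg_apply, Matrix.zero_apply, Matrix.vecMulVec_apply,
      Matrix.diagonal_apply, Pi.add_apply, Pi.neg_apply, hc]
    by_cases hi : i.val = n <;> by_cases hj : j.val = n <;> by_cases hij : i = j <;>
      simp [hi, hj, hij] <;> first | (subst hij; omega) | (exfalso; apply hij; ext; omega) | skip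

lemma ww_im_aux (β : ι) (σ : ℕ → ι) (c : ι → ℕ → ℚ) (hc : ∀ n, c β n = 0) (m K : ℕ) :
    hm β c m (FreeGroup.mk ((List.range (4 * K)).map fun k =>
      (((wl β σ k).1, (wl β σ k).2.1), (wl β σ k).2.2)))
    = ⟨0, 0, Matrix.diagonal fun i => if i.val < K then c (σ i.val) i.val else 0⟩ := by
  induction K with
  | zero =>
    rw [show 4 * 0 = 0 from rfl]
    simp only [List.range_zero, List.map_nil]
    rw [← FreeGroup.one_eq_mk, map_one]
    ext <;> simp
  | succ K ih =>
    have e : List.range (4 * (K + 1)) =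
        List.range (4 * K) ++ [4 * K, 4 * K + 1, 4 * K + 2, 4 * K + 3] := by
      rw [show 4 * (K + 1) = 4 * K + 1 + 1 + 1 + 1 by ring]
      simp [List.range_succ]
    rw [e, List.map_append, ← FreeGroup.mul_mk, map_mul, ih]
    have e2 : hm β c m (FreeGroup.mk (([4 * K, 4 * K + 1, 4 * K + 2, 4 * K + 3]).map fun k =>
      (((wl β σ k).1, (wl β σ k).2.1), (wl β σ k).2.2)))
      = letterIm β c m (σ K, K) * letterIm β c m (β, K) * (letterIm β c m (σ K, K))⁻¹
      * (letterIm β c m (β, K))⁻¹ := by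
      have d0 : wl β σ (4 * K) = (σ K, K, true) := by
        simp [wl, show (4 * K) % 2 = 0 by omega]
      have d1 : wl β σ (4 * K + 1) = (β, K, true) := by
        simp [wl, show (4 * K + 1) % 2 = 1 by omega, show (4 * K + 1) / 4 = K by omega,
          show (4 * K + 1) % 4 = 1 by omega]
      have d2 : wl β σ (4 * K + 2) = (σ K, K, false) := by
        simp [wl, show (4 * K + 2) % 2 = 0 by omega, show (4 * K + 2) / 4 = K by omega,
          show (4 * K + 2) % 4 = 2 by omega]
      have d3 : wl β σ (4 * K + 3) = (β, K, false) := by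
        simp [wl, show (4 * K + 3) % 2 = 1 by omega, show (4 * K + 3) / 4 = K by omega,
          show (4 * K + 3) % 4 = 3 by omega]
      unfold hm
      rw [FreeGroup.lift_mk]
      simp [d0, d1, d2, d3, mul_assoc]
    rw [e2, comm_im _ _ _ hc]
    ext i j
    · simp
    · simp
    · simp only [Heis.mul_M, Matrix.add_apply, Matrix.diagonal_apply, Matrix.vecMulVec_apply]
      by_cases hij : i = j
      · subst hij
        rcases lt_trichotomy i.val K with h | h | h
        · simp [h, h.ne, h.trans (Nat.lt_succ_self K)]
        · simp [h]
        · simp [h.not_gt, h.ne', show ¬ i.val < K + 1 by omega]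
      · simp [hij]

lemma ww_im (β : ι) (σ : ℕ → ι) (c : ι → ℕ → ℚ) (hc : ∀ n, c β n = 0) (N : ℕ) :
    hm β c (N + 1) ((ww β σ).Phi N)
    = ⟨0, 0, Matrix.diagonal fun i => c (σ i.val) i.val⟩ := by
  show hm β c (N + 1) ((ww β σ).trunc N) = _
  rw [ww_trunc, ww_im_aux _ _ _ hc]
  congr
  funext i
  simp [i.2]

/-- Words whose defining sequences differ infinitely often have different classes. -/
lemma coneClass_ne (β : ι) (σ τ : ℕ → ι) (h : {n | σ n ≠ τ n}.Infinite) :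
    coneClass (ww β σ) ≠ coneClass (ww β τ) := by
  classical
  intro heq
  let c : ι → ℕ → ℚ := fun α n =>
    if α = β then 0 else if α = σ n then 1 else if α = τ n then 2 else 0
  have hc : ∀ n, c β n = 0 := fun n => by simp [c]
  have hd : ∀ n, σ n ≠ τ n → -c (σ n) n + c (τ n) n ≠ 0 := by
    intro n hn
    by_cases h1 : σ n = β
    · have h2 : τ n ≠ β := fun h => hn (h1.trans h.symm)
      simp [c, h1, h2]
    · by_cases h2 : τ n = β
      · simp [c, h1, h2]
      · simp [c, h1, h2, hn.symm]; norm_num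
  have hmem := (Subgroup.normalClosure_le_normal (pure_bdd β c hc)) (QuotientGroup.eq.1 heq)
  obtain ⟨k, hk⟩ := hmem
  obtain ⟨s, hs, hcard⟩ := h.exists_subset_card_eq (k + 1)
  obtain ⟨N, hN⟩ := s.exists_nat_subset_range
  have hkN := hk N
  simp only [Subgroup.coe_mul, Subgroup.coe_inv, Pi.mul_apply, Pi.inv_apply, map_mul, map_inv] at hkN
  rw [ww_im _ _ _ hc, ww_im _ _ _ hc] at hkN
  have e : ((⟨0, 0, Matrix.diagonal fun i => c (σ i.val) i.val⟩ : Heis (N + 1))⁻¹ *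
      ⟨0, 0, Matrix.diagonal fun i => c (τ i.val) i.val⟩).M
      = Matrix.diagonal fun i : Fin (N + 1) => -c (σ i.val) i.val + c (τ i.val) i.val := by
    ext i j
    by_cases hij : i = j
    · subst hij; simp [Matrix.vecMulVec_apply]
    · simp [Matrix.vecMulVec_apply, hij]
  rw [e, Matrix.rank_diagonal] at hkN
  have hinj : k + 1 ≤ Fintype.card {i : Fin (N + 1) // -c (σ i.val) i.val + c (τ i.val) i.val ≠ 0} := by
    rw [← hcard, ← Fintype.card_coe s]
    refine Fintype.card_le_of_injective (fun n => ⟨⟨n.1, ?_⟩, ?_⟩) ?_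
    · have := Finset.mem_range.1 (hN n.2); omega
    · exact hd n.1 (hs n.2)
    · intro a b hab
      simp at hab
      exact hab
  omega

lemma lower (β : ι) : Cardinal.mk ι ^ Cardinal.aleph0 ≤ Cardinal.mk (ConeGroup ι) := by
  have h : Cardinal.mk ι ^ Cardinal.aleph0 = Cardinal.mk (ℕ → ι) := by simp
  rw [h]
  refine Cardinal.mk_le_of_injective
    (f := fun σ : ℕ → ι => coneClass (ww β (fun n => σ n.unpair.1))) ?_
  intro σ τ heq
  by_contra hne
  obtain ⟨i, hi⟩ := Function.ne_iff.1 hne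
  refine coneClass_ne β _ _ ?_ heq
  refine Set.infinite_of_injective_forall_mem (f := fun j : ℕ => Nat.pair i j) ?_ ?_
  · intro a b hab
    have := congrArg Nat.unpair hab
    simpa using this
  · intro j
    simpa using hi

lemma upper [Nontrivial ι] : Cardinal.mk (ConeGroup ι) ≤ Cardinal.mk ι ^ Cardinal.aleph0 := by
  have h1 : Cardinal.mk (ConeGroup ι) ≤ Cardinal.mk (wordGroup ι) := Cardinal.mk_quotient_le
  have h2 : Cardinal.mk (wordGroup ι) ≤ Cardinal.mk (ℕ → FreeGroup (ι × ℕ)) :=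
    Cardinal.mk_subtype_le _
  have h3 : Cardinal.mk (ℕ → FreeGroup (ι × ℕ))
      = (Cardinal.mk (FreeGroup (ι × ℕ))) ^ Cardinal.aleph0 := by simp
  have hinf : Cardinal.aleph0 ≤ Cardinal.mk ι ^ Cardinal.aleph0 := by
    refine (Cardinal.cantor _).le.trans (Cardinal.power_le_power_right ?_)
    rw [Cardinal.two_le_iff]
    exact exists_pair_ne ι
  have hself : Cardinal.mk ι ≤ Cardinal.mk ι ^ Cardinal.aleph0 :=
    Cardinal.self_le_power _ Cardinal.one_le_aleph0
  have h4 : Cardinal.mk (FreeGroup (ι × ℕ)) ≤ Cardinal.mk ι ^ Cardinal.aleph0 := by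
    rw [Cardinal.mk_freeGroup]
    refine max_le ?_ hinf
    rw [Cardinal.mk_prod]
    simp only [Cardinal.lift_id, Cardinal.mk_nat]
    exact Cardinal.mul_le_of_le hinf hself hinf
  refine h1.trans (h2.trans (h3.le.trans ((Cardinal.power_le_power_right h4).trans ?_)))
  rw [← Cardinal.power_mul, Cardinal.aleph0_mul_aleph0]

end ConeCard

open GriffithsWords in
/-- **Theorem.** For every cardinal `κ` (realized as the cardinality of a type `ι`), the
cone group `𝒞_κ` has cardinality `1` if `κ = 0` and cardinality `κ^ℵ₀` if `κ ≥ 1`. -/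
theorem card_coneGroup (ι : Type) :
    (IsEmpty ι → Cardinal.mk (ConeGroup ι) = 1) ∧
    (Nonempty ι → Cardinal.mk (ConeGroup ι) = Cardinal.mk ι ^ Cardinal.aleph0) := by
  constructor
  · intro h
    have : Subsingleton (ConeGroup ι) := ConeCard.subsingleton_cone
    exact le_antisymm (Cardinal.le_one_iff_subsingleton.2 this)
      (Cardinal.one_le_iff_ne_zero.2 (Cardinal.mk_ne_zero_iff.2 ⟨1⟩))
  · rintro ⟨β⟩
    rcases subsingleton_or_nontrivial ι with h | h
    · have : Subsingleton (ConeGroup ι) := ConeCard.subsingleton_cone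
      have e1 : Cardinal.mk (ConeGroup ι) = 1 :=
        le_antisymm (Cardinal.le_one_iff_subsingleton.2 this)
          (Cardinal.one_le_iff_ne_zero.2 (Cardinal.mk_ne_zero_iff.2 ⟨1⟩))
      have e2 : Cardinal.mk ι = 1 :=
        le_antisymm (Cardinal.le_one_iff_subsingleton.2 h)
          (Cardinal.one_le_iff_ne_zero.2 (Cardinal.mk_ne_zero_iff.2 ⟨β⟩))
      rw [e1, e2, Cardinal.one_power]
    · exact le_antisymm ConeCard.upper (ConeCard.lower β)
end
end

section
/- Let κ be a cardinal. A reduced word W ∈ Red_κ lies in the kernel of the quotient map Red_κ → 𝒞_κ if and only if there exist finitely many intervals I₀, …, I_p of W̄ such that the restriction W↾I_j is a pure word for each 0 ≤ j ≤ p, and Red(W↾(W̄ ∖ (I₀ ∪ ⋯ ∪ I_p))) = E. -/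
noncomputable section

namespace GWaux

set_option linter.unusedSectionVars false

section comb
variable {ι G : Type} [Group G]

def lof (a : ι × G) : Monoid.CoprodI (fun _ : ι => G) :=
  Monoid.CoprodI.of (M := fun _ : ι => G) (i := a.1) a.2

def ev (w : List (ι × G)) : Monoid.CoprodI (fun _ : ι => G) := (w.map lof).prod

@[simp] lemma ev_nil : ev ([] : List (ι × G)) = 1 := rfl
@[simp] lemma ev_cons (a : ι × G) (w) : ev (a :: w) = lof a * ev w := by simp [ev]
@[simp] lemma ev_append (v w : List (ι × G)) : ev (v ++ w) = ev v * ev w := by simp [ev]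
@[simp] lemma lof_one (α : ι) : lof (α, (1 : G)) = 1 := by simp [lof]
lemma lof_mul (α : ι) (g h : G) : lof (α, g * h) = lof (α, g) * lof (α, h) := by simp [lof]
lemma lof_inv (α : ι) (g : G) : lof (α, g⁻¹) = (lof (α, g))⁻¹ := by simp [lof]

def Normal (w : List (ι × G)) : Prop :=
  (∀ a ∈ w, a.2 ≠ 1) ∧ (w.map Prod.fst).IsChain (· ≠ ·)

lemma exists_of_not_normal (w : List (ι × G)) (h : ¬ Normal w) :
    (∃ x y β, w = x ++ (β, 1) :: y) ∨ (∃ x y β g h, w = x ++ (β, g) :: (β, h) :: y) := by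
  induction w with
  | nil => exact absurd (by simp [Normal]) h
  | cons a w ih =>
    by_cases ha : a.2 = 1
    · left; refine ⟨[], w, a.1, ?_⟩; simp [← ha]
    by_cases hw : Normal w
    · cases w with
      | nil => exact absurd (by simp [Normal, ha]) h
      | cons b w =>
        by_cases hab : a.1 = b.1
        · right; refine ⟨[], w, a.1, a.2, b.2, ?_⟩; simp [hab]; rw [← hab]
        · refine absurd ?_ h
          obtain ⟨h1, h2⟩ := hw
          refine ⟨?_, ?_⟩
          · intro c hc; rcases List.mem_cons.1 hc with rfl | hc
            · exact ha
            · exact h1 c hc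
          · simp only [List.map_cons, List.isChain_cons_cons] at h2 ⊢
            exact ⟨hab, h2⟩
    · rcases ih hw with ⟨x, y, β, rfl⟩ | ⟨x, y, β, g, k, rfl⟩
      · left; exact ⟨a :: x, y, β, rfl⟩
      · right; exact ⟨a :: x, y, β, g, k, rfl⟩

def Normal.toW {w : List (ι × G)} (h : Normal w) : Monoid.CoprodI.Word (fun _ : ι => G) where
  toList := w.map (fun a => ⟨a.1, a.2⟩)
  ne_one := by
    intro l hl
    obtain ⟨a, ha, rfl⟩ := List.mem_map.1 hl
    exact h.1 a ha
  chain_ne := by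
    have := h.2
    rw [List.isChain_map] at this ⊢
    exact this

lemma Normal.prod_toW {w : List (ι × G)} (h : Normal w) : h.toW.prod = ev w := by
  simp [Monoid.CoprodI.Word.prod, Normal.toW, ev, Function.comp_def]
  rfl

lemma Normal.eq_of_ev {w v : List (ι × G)} (h : Normal w) (h' : Normal v) (e : ev w = ev v) :
    w = v := by
  classical
  rw [← h.prod_toW, ← h'.prod_toW] at e
  have := (Monoid.CoprodI.Word.equiv (M := fun _ : ι => G)).symm.injective e
  have h2 := congrArg Monoid.CoprodI.Word.toList this
  simp only [Normal.toW] at h2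
  refine List.map_injective_iff.2 ?_ h2
  rintro ⟨a, b⟩ ⟨c, d⟩ h
  simp only [Sigma.mk.injEq, heq_eq_eq] at h
  simpa using h

lemma Normal.nil_of_ev {w : List (ι × G)} (h : Normal w) (e : ev w = 1) : w = [] :=
  h.eq_of_ev (v := []) (by simp [Normal]) (by simpa using e)

lemma Normal.single_of_ev {w : List (ι × G)} (h : Normal w) {α : ι} {g : G}
    (e : ev w = lof (α, g)) : w = [] ∨ ∃ β k, w = [(β, k)] := by
  by_cases hg : g = 1
  · left; subst hg; exact h.nil_of_ev (by simpa using e)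
  · right; exact ⟨α, g, h.eq_of_ev (by simp [Normal, hg]) (by simpa using e)⟩

lemma ev_surj (x : Monoid.CoprodI (fun _ : ι => G)) : ∃ w : List (ι × G), ev w = x := by
  induction x using Monoid.CoprodI.induction_on with
  | one => exact ⟨[], rfl⟩
  | of i m => exact ⟨[(i, m)], by simp [lof]⟩
  | mul x y hx hy =>
    obtain ⟨a, rfl⟩ := hx
    obtain ⟨b, rfl⟩ := hy
    exact ⟨a ++ b, by simp⟩

inductive Chg : ℕ → List (ι × G) → List (ι × G) → Prop
  | nil (k) : Chg k [] []
  | same {k w z} (a) (h : Chg k w z) : Chg k (a :: w) (a :: z)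
  | diff {k w z} (α g g') (h : Chg k w z) : Chg (k + 1) ((α, g) :: w) ((α, g') :: z)

lemma Chg.refl (k) (w : List (ι × G)) : Chg k w w := by
  induction w with
  | nil => exact .nil k
  | cons a w ih => exact .same a ih

lemma Chg.mono {k l} {w z : List (ι × G)} (h : Chg k w z) (hl : k ≤ l) : Chg l w z := by
  induction h generalizing l with
  | nil k => exact .nil l
  | same a h ih => exact .same a (ih hl)
  | diff α g g' h ih =>
    obtain ⟨l, rfl⟩ : ∃ m, l = m + 1 := ⟨l - 1, by omega⟩
    exact .diff α g g' (ih (by omega))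

lemma Chg.append {k l} {w z w' z' : List (ι × G)} (h : Chg k w z) (h' : Chg l w' z') :
    Chg (k + l) (w ++ w') (z ++ z') := by
  induction h with
  | nil k => exact h'.mono (by omega)
  | same a h ih => exact .same a ih
  | diff α g g' h ih =>
    have := Chg.diff α g g' ih
    exact this.mono (by omega)

lemma Chg.trans {k l} {w z v : List (ι × G)} (h : Chg k w z) (h' : Chg l z v) :
    Chg (k + l) w v := by
  induction h generalizing l v with
  | nil k => exact h'.mono (by omega)
  | same a h ih =>
    cases h' with
    | same _ h' => exact .same _ (ih h')
    | diff α g g' h' => exact (Chg.diff _ _ _ (ih h')).mono (by omega)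
  | diff α g g' h ih =>
    cases h' with
    | same _ h' => exact (Chg.diff _ _ _ (ih h')).mono (by omega)
    | diff α g g' h' => exact (Chg.diff _ _ _ (ih h')).mono (by omega)

lemma Chg.split {k} {x y z : List (ι × G)} (h : Chg k (x ++ y) z) :
    ∃ k1 k2 x' y', k1 + k2 = k ∧ z = x' ++ y' ∧ Chg k1 x x' ∧ Chg k2 y y' := by
  induction x generalizing k z with
  | nil => exact ⟨0, k, [], z, by omega, rfl, .nil 0, h⟩
  | cons a x ih =>
    cases h with
    | same _ h =>
      obtain ⟨k1, k2, x', y', hk, rfl, h1, h2⟩ := ih h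
      exact ⟨k1, k2, a :: x', y', hk, rfl, .same a h1, h2⟩
    | diff α g g' h =>
      obtain ⟨k1, k2, x', y', hk, rfl, h1, h2⟩ := ih h
      exact ⟨k1 + 1, k2, (α, g') :: x', y', by omega, rfl, .diff _ _ _ h1, h2⟩

/-- at most `k` letters can be changed to make the word trivial -/
def Ct (k : ℕ) (w : List (ι × G)) : Prop := ∃ z, Chg k w z ∧ ev z = 1

lemma Ct.merge {k} {x y : List (ι × G)} {α g h} (H : Ct k (x ++ (α, g) :: (α, h) :: y)) :
    Ct k (x ++ (α, g * h) :: y) := by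
  obtain ⟨z, hz, e⟩ := H
  obtain ⟨k1, k2, x', y', rfl, rfl, h1, h2⟩ := hz.split
  cases h2 with
  | same _ h2 =>
    cases h2 with
    | same _ h2 =>
      refine ⟨_, h1.append (.same _ h2), ?_⟩
      simpa [lof_mul, mul_assoc] using e
    | diff _ _ h' h2 =>
      refine ⟨_, h1.append (.diff α _ (g * h') h2), ?_⟩
      simpa [lof_mul, mul_assoc] using e
  | diff _ _ g' h2 =>
    cases h2 with
    | same _ h2 =>
      refine ⟨_, h1.append (.diff α _ (g' * h) h2), ?_⟩
      simpa [lof_mul, mul_assoc] using e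
    | diff _ _ h' h2 =>
      refine ⟨_, (h1.append (.diff α _ (g' * h') h2)).mono (by omega), ?_⟩
      simpa [lof_mul, mul_assoc] using e

lemma Ct.unmerge {k} {x y : List (ι × G)} {α g h} (H : Ct k (x ++ (α, g * h) :: y)) :
    Ct k (x ++ (α, g) :: (α, h) :: y) := by
  obtain ⟨z, hz, e⟩ := H
  obtain ⟨k1, k2, x', y', rfl, rfl, h1, h2⟩ := hz.split
  cases h2 with
  | same _ h2 =>
    refine ⟨_, h1.append (.same _ (.same _ h2)), ?_⟩
    simpa [lof_mul, mul_assoc] using e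
  | diff _ _ c h2 =>
    refine ⟨_, h1.append (.diff α _ (c * h⁻¹) (.same _ h2)), ?_⟩
    simpa [lof_mul, lof_inv, mul_assoc] using e

lemma Ct.undrop {k} {x y : List (ι × G)} {α} (H : Ct k (x ++ y)) :
    Ct k (x ++ (α, 1) :: y) := by
  obtain ⟨z, hz, e⟩ := H
  obtain ⟨k1, k2, x', y', rfl, rfl, h1, h2⟩ := hz.split
  refine ⟨_, h1.append (.same _ h2), ?_⟩
  simpa using e

lemma Ct.rotate {k} {x y : List (ι × G)} (H : Ct k (x ++ y)) : Ct k (y ++ x) := by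
  obtain ⟨z, hz, e⟩ := H
  obtain ⟨k1, k2, x', y', rfl, rfl, h1, h2⟩ := hz.split
  refine ⟨_, (h2.append h1).mono (by omega), ?_⟩
  rw [ev_append] at e ⊢
  exact mul_eq_one_comm.1 e

lemma ct_one_of_ev (n : ℕ) : ∀ w : List (ι × G), w.length = n → ∀ α g, ev w = lof (α, g) →
    Ct 1 w := by
  induction n using Nat.strong_induction_on with
  | _ n ih =>
    intro w hw α g e
    by_cases hn : Normal w
    · rcases hn.single_of_ev e with rfl | ⟨β, k, rfl⟩
      · exact ⟨[], .nil 1, rfl⟩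
      · exact ⟨[(β, 1)], .diff _ _ _ (.nil 0), by simp⟩
    · rcases exists_of_not_normal w hn with ⟨x, y, β, rfl⟩ | ⟨x, y, β, u, v, rfl⟩
      · exact (ih (x ++ y).length (by simp at hw ⊢; omega) _ rfl α g (by simpa using e)).undrop
      · exact (ih (x ++ (β, u * v) :: y).length (by simp at hw ⊢; omega) _ rfl α g
          (by simpa [lof_mul, mul_assoc] using e)).unmerge

lemma Ct.drop {k} {x y : List (ι × G)} {α} (H : Ct k (x ++ (α, 1) :: y)) : Ct k (x ++ y) := by
  obtain ⟨z, hz, e⟩ := H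
  obtain ⟨k1, k2, x', y', rfl, rfl, h1, h2⟩ := hz.split
  cases h2 with
  | same _ h2 =>
    refine ⟨_, h1.append h2, ?_⟩
    simpa using e
  | @diff k2 _ y' _ _ c h2 =>
    have e2 : ev (y' ++ x') = lof (α, c⁻¹) := by
      rw [lof_inv, eq_inv_iff_mul_eq_one, ev_append, mul_assoc, mul_eq_one_comm]
      simpa [mul_assoc] using e
    obtain ⟨z, hz, e3⟩ := (ct_one_of_ev _ _ rfl _ _ e2).rotate
    exact ⟨z, ((h1.append h2).trans hz).mono (by omega), e3⟩

lemma Ct.remove {k} (n : ℕ) : ∀ x u y : List (ι × G), u.length = n → ev u = 1 →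
    Ct k (x ++ (u ++ y)) → Ct k (x ++ y) := by
  induction n using Nat.strong_induction_on with
  | _ n ih =>
    intro x u y hn e H
    by_cases hu : Normal u
    · rw [hu.nil_of_ev e] at H; simpa using H
    · rcases exists_of_not_normal u hu with ⟨s, t, β, rfl⟩ | ⟨s, t, β, g, h, rfl⟩
      · refine ih (s ++ t).length (by simp at hn ⊢; omega) x (s ++ t) y rfl (by simpa using e) ?_
        have : Ct k ((x ++ s) ++ (β, 1) :: (t ++ y)) := by simpa using H
        simpa using this.drop
      · refine ih (s ++ (β, g * h) :: t).length (by simp at hn ⊢; omega) x _ y rfl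
          (by simpa [lof_mul, mul_assoc] using e) ?_
        have : Ct k ((x ++ s) ++ (β, g) :: (β, h) :: (t ++ y)) := by simpa using H
        simpa using this.merge

lemma Ct.of_ev_eq {k} {w v : List (ι × G)} (e : ev w = ev v) (H : Ct k w) : Ct k v := by
  obtain ⟨v', hv'⟩ := ev_surj (ev v)⁻¹
  have : Ct k (v ++ ((v' ++ w) ++ [])) := by
    obtain ⟨z, hz, ez⟩ := H
    refine ⟨v ++ (v' ++ z), ?_, by simp [ez, hv']⟩
    have := (Chg.refl 0 v).append ((Chg.refl 0 v').append hz)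
    simpa using this
  simpa using Ct.remove _ v _ [] rfl (by simp [hv', e]) this

/-- product of `k` conjugates-type norm -/
def Nm (k : ℕ) (x : Monoid.CoprodI (fun _ : ι => G)) : Prop := ∀ w, ev w = x → Ct k w

lemma Nm.of_ct {k} {w : List (ι × G)} (H : Ct k w) : Nm k (ev w) := fun _ hv => H.of_ev_eq hv.symm

lemma Nm.one : Nm 0 (1 : Monoid.CoprodI (fun _ : ι => G)) :=
  Nm.of_ct (w := []) ⟨[], .nil 0, rfl⟩

lemma Nm.mul {k l} {x y : Monoid.CoprodI (fun _ : ι => G)} (hx : Nm k x) (hy : Nm l y) :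
    Nm (k + l) (x * y) := by
  obtain ⟨a, rfl⟩ := ev_surj x
  obtain ⟨b, rfl⟩ := ev_surj y
  obtain ⟨z, hz, e⟩ := hx a rfl
  obtain ⟨z', hz', e'⟩ := hy b rfl
  rw [← ev_append]
  exact Nm.of_ct ⟨_, hz.append hz', by simp [e, e']⟩

def invL (w : List (ι × G)) : List (ι × G) := (w.map fun a => (a.1, a.2⁻¹)).reverse

lemma ev_invL (w : List (ι × G)) : ev (invL w) = (ev w)⁻¹ := by
  induction w with
  | nil => simp [invL]
  | cons a w ih =>
    have : invL (a :: w) = invL w ++ [(a.1, a.2⁻¹)] := by simp [invL]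
    rw [this]; simp [ih, lof_inv]

lemma Chg.inv {k} {w z : List (ι × G)} (h : Chg k w z) : Chg k (invL w) (invL z) := by
  induction h with
  | nil k => exact .nil k
  | @same k w z a h ih =>
    have := ih.append (Chg.refl 0 [(a.1, a.2⁻¹)])
    simpa [invL] using this
  | @diff k w z α g g' h ih =>
    have := ih.append (Chg.diff α g⁻¹ g'⁻¹ (.nil 0))
    simpa [invL] using this

lemma Nm.inv {k} {x : Monoid.CoprodI (fun _ : ι => G)} (hx : Nm k x) : Nm k x⁻¹ := by
  obtain ⟨a, rfl⟩ := ev_surj x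
  obtain ⟨z, hz, e⟩ := hx a rfl
  rw [← ev_invL]
  exact Nm.of_ct ⟨_, hz.inv, by simp [ev_invL, e]⟩

lemma Nm.conj (x : Monoid.CoprodI (fun _ : ι => G)) (α : ι) (g : G) :
    Nm 1 (x * lof (α, g) * x⁻¹) := by
  obtain ⟨a, rfl⟩ := ev_surj x
  rw [← ev_invL]
  have : Nm 1 (ev (a ++ (α, g) :: invL a)) := by
    refine Nm.of_ct ⟨a ++ (α, 1) :: invL a, ?_, by simp [ev_invL]⟩
    exact (Chg.refl 0 a).append (.diff _ _ _ (Chg.refl 0 _))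
  simpa [mul_assoc] using this

/-! marked words -/

def strip (a : ι × G × Bool) : ι × G := (a.1, a.2.1)

def unm (X : List (ι × G × Bool)) : List (ι × G) := (X.filter (fun a => !a.2.2)).map strip

@[simp] lemma unm_nil : unm ([] : List (ι × G × Bool)) = [] := rfl
@[simp] lemma unm_append (X Y : List (ι × G × Bool)) : unm (X ++ Y) = unm X ++ unm Y := by
  simp [unm]
@[simp] lemma unm_cons_true (α : ι) (g : G) (Y) : unm ((α, g, true) :: Y) = unm Y := by
  simp [unm]
@[simp] lemma unm_cons_false (α : ι) (g : G) (Y) :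
    unm ((α, g, false) :: Y) = (α, g) :: unm Y := by
  simp [unm, strip]

def nM (X : List (ι × G × Bool)) : ℕ := X.countP (fun a => a.2.2)
open Classical in
noncomputable def nT (X : List (ι × G × Bool)) : ℕ := X.countP (fun a => a.2.2 && decide (a.2.1 = 1))

lemma nT_le (X : List (ι × G × Bool)) : nT X ≤ nM X := by
  unfold nT nM
  apply List.countP_mono_left
  intro a _ h
  simp at h
  exact h.1

structure Ok (X : List (ι × G × Bool)) : Prop where
  chain : (X.map Prod.fst).IsChain (· ≠ ·)
  ne : ∀ α g, (α, g, false) ∈ X → g ≠ 1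
  ev1 : ev (X.map strip) = 1

def Concl (d : ℕ) (X : List (ι × G × Bool)) : Prop :=
  ∃ L, L.Sublist (unm X) ∧ ev L = 1 ∧ (unm X).length ≤ L.length + d

lemma del (n : ℕ) : ∀ X : List (ι × G × Bool), X.length = n → Ok X →
    Concl (2 * nM X ^ 2 + 2 * nT X) X := by
  induction n using Nat.strong_induction_on with
  | _ n ih =>
    intro X hn hX
    by_cases hX0 : X = []
    · subst hX0; exact ⟨[], by simp, by simp, by simp⟩
    -- find trivial marked letter
    have hnn : ¬ Normal (X.map strip) := by
      intro h
      exact hX0 (by simpa using h.nil_of_ev hX.ev1)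
    have : ∃ x y β, X = x ++ (β, (1 : G), true) :: y := by
      have h1 : ∃ a ∈ X.map strip, a.2 = 1 := by
        by_contra hc
        push Not at hc
        refine hnn ⟨hc, ?_⟩
        simpa [strip, Function.comp_def] using hX.chain
      obtain ⟨a, ha, ha1⟩ := h1
      obtain ⟨⟨β, g, m⟩, hb, rfl⟩ := List.mem_map.1 ha
      simp only [strip] at ha1
      subst ha1
      cases m with
      | false => exact absurd rfl (hX.ne _ _ hb)
      | true =>
        obtain ⟨x, y, rfl⟩ := List.append_of_mem hb
        exact ⟨x, y, β, rfl⟩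
    obtain ⟨x, y, β, rfl⟩ := this
    have hev : ev (x.map strip) * ev (y.map strip) = 1 := by
      simpa [strip] using hX.ev1
    have hch := hX.chain
    -- easy case
    by_cases hc : ((x ++ y).map Prod.fst).IsChain (· ≠ ·)
    · obtain ⟨L, h1, h2, h3⟩ := ih (x ++ y).length (by simp at hn ⊢; omega) (x ++ y) rfl
        ⟨hc, fun α g h => hX.ne α g (by simp at h ⊢; tauto), by simpa using hev⟩
      refine ⟨L, by simpa using h1, h2, ?_⟩
      have e1 : nM (x ++ (β, (1 : G), true) :: y) = nM (x ++ y) + 1 := by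
        simp [nM]; omega
      have e2 := nT_le (x ++ y)
      have e3 : unm (x ++ (β, (1 : G), true) :: y) = unm (x ++ y) := by simp
      rw [e1, e3]
      nlinarith
    rcases List.eq_nil_or_concat x with rfl | ⟨x, ⟨γ, g, m⟩, rfl⟩
    · exact absurd (by simpa using hch.tail) hc
    rcases y with _ | ⟨⟨γ', h, m'⟩, y⟩
    · exfalso; apply hc
      have := hch
      simp only [List.map_append, List.map_cons] at this
      simpa using this.left_of_append
    simp only [List.append_assoc, List.map_append, List.map_cons, List.map_nil, List.concat_eq_append,
      List.cons_append, List.nil_append] at hc hch hev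
    have hγ : γ = γ' := by
      by_contra hne
      apply hc
      rw [List.isChain_split, List.isChain_cons_cons] at hch ⊢
      refine ⟨hch.1, hne, ?_⟩
      exact hch.2.2.tail
    subst hγ
    have hch' : (x.map Prod.fst ++ γ :: y.map Prod.fst).IsChain (· ≠ ·) := by
      rw [List.isChain_split] at hch ⊢
      exact ⟨hch.1, hch.2.tail.tail⟩
    have hev' : ev (x.map strip) * (lof (γ, g * h) * ev (y.map strip)) = 1 := by
      simpa [strip, lof_mul, mul_assoc] using hev
    have hnx : ∀ α g, (α, g, false) ∈ x → g ≠ 1 := fun α g h => hX.ne α g (by simp [h])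
    have hny : ∀ α g, (α, g, false) ∈ y → g ≠ 1 := fun α g h => hX.ne α g (by simp [h])
    obtain ⟨L, h1, h2, h3⟩ := ih (x ++ (γ, g * h, true) :: y).length
      (by simp at hn ⊢; omega) (x ++ (γ, g * h, true) :: y) rfl
        ⟨by simpa using hch', fun α k h => by
          simp at h
          rcases h with h | h
          · exact hnx _ _ h
          · exact hny _ _ h, by simpa [strip] using hev'⟩
    simp only [unm_append, unm_cons_true] at h1 h3
    have eM : nM (x ++ (γ, g * h, true) :: y) = nM x + nM y + 1 := by simp [nM]; omega
    have eT := nT_le (x ++ (γ, g * h, true) :: y)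
    rw [eM] at h3 eT
    simp only [List.length_append] at h3
    rcases m with _ | _
    · rcases m' with _ | _
      · -- both unmarked
        have fM : nM (x.concat (γ, g, false) ++ (β, 1, true) :: (γ, h, false) :: y)
            = nM x + nM y + 1 := by simp [nM]; omega
        have fT : nT (x.concat (γ, g, false) ++ (β, 1, true) :: (γ, h, false) :: y)
            = nT x + nT y + 1 := by simp [nT]; omega
        unfold Concl
        rw [fM, fT]
        by_cases hgh : g * h = 1
        · have gT : nT (x ++ (γ, g * h, true) :: y) = nT x + nT y + 1 := by
            simp [nT, hgh]; omega
          obtain ⟨L1, L2, rfl, hL1, hL2⟩ := List.sublist_append_iff.1 h1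
          refine ⟨L1 ++ (γ, g) :: (γ, h) :: L2, ?_, ?_, ?_⟩
          · simp
            exact hL1.append ((hL2.cons_cons _).cons_cons _)
          · have : lof (γ, g) * (lof (γ, h) * ev L2) = ev L2 := by
              rw [← mul_assoc, ← lof_mul, hgh]; simp
            simpa [this] using h2
          · rw [gT] at h3
            simp at h3 ⊢
            omega
        · have gT : nT (x ++ (γ, g * h, true) :: y) = nT x + nT y := by
            simp [nT, hgh]
          refine ⟨L, ?_, h2, ?_⟩
          · simp
            refine h1.trans ?_
            exact (List.Sublist.refl _).append ((List.sublist_cons_self _ _).trans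
              (List.sublist_cons_self _ _))
          · rw [gT] at h3
            simp at h3 ⊢
            omega
      · have fM : nM (x.concat (γ, g, false) ++ (β, 1, true) :: (γ, h, true) :: y)
            = nM x + nM y + 2 := by simp [nM]; omega
        unfold Concl
        rw [fM]
        refine ⟨L, ?_, h2, ?_⟩
        · simp
          refine h1.trans ?_
          exact (List.Sublist.refl _).append (List.sublist_cons_self _ _)
        · simp at h3 ⊢
          nlinarith
    · refine ⟨L, ?_, h2, ?_⟩
      · cases m'
        · simp
          refine h1.trans ?_
          exact (List.Sublist.refl _).append (List.sublist_cons_self _ _)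
        · simpa using h1
      · have fM : nM (x.concat (γ, g, true) ++ (β, 1, true) :: (γ, h, m') :: y)
            ≥ nM x + nM y + 2 := by simp [nM, List.countP_cons]; omega
        have fU : (unm (x.concat (γ, g, true) ++ (β, 1, true) :: (γ, h, m') :: y)).length
            ≤ (unm x).length + (unm y).length + 1 := by
          cases m' <;> simp; omega
        refine fU.trans ?_
        nlinarith

lemma Chg.marked {k} {w z : List (ι × G)} (h : Chg k w z) :
    ∃ X : List (ι × G × Bool), X.map strip = z ∧ X.map Prod.fst = w.map Prod.fst ∧
      nM X ≤ k ∧ (unm X).Sublist w ∧ w.length = (unm X).length + nM X := by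
  induction h with
  | nil k => exact ⟨[], by simp [nM]⟩
  | same a h ih =>
    obtain ⟨X, h1, h2, h3, h4, h5⟩ := ih
    refine ⟨(a.1, a.2, false) :: X, by simp [h1, strip], by simp [h2], by simpa [nM] using h3,
      ?_, ?_⟩
    · simpa using h4
    · simp [nM] at h5 ⊢; omega
  | diff α g g' h ih =>
    obtain ⟨X, h1, h2, h3, h4, h5⟩ := ih
    refine ⟨(α, g', true) :: X, by simp [h1, strip], by simp [h2], by simpa [nM] using h3, ?_, ?_⟩
    · simpa using h4.cons _
    · simp [nM] at h5 ⊢; omega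

/-- Main finite combinatorial statement. -/
theorem finite_main {k} {w : List (ι × G)} (hw : Normal w) (H : Nm k (ev w)) :
    ∃ L, L.Sublist w ∧ ev L = 1 ∧ w.length ≤ L.length + (2 * k ^ 2 + 3 * k) := by
  obtain ⟨z, hz, e⟩ := H w rfl
  obtain ⟨X, h1, h2, h3, h4, h5⟩ := hz.marked
  have hne : ∀ α g, (α, g, false) ∈ X → g ≠ 1 := by
    intro α g hg
    refine hw.1 (α, g) (h4.subset ?_)
    exact List.mem_map.2 ⟨_, List.mem_filter.2 ⟨hg, rfl⟩, rfl⟩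
  obtain ⟨L, g1, g2, g3⟩ := del _ X rfl ⟨by rw [h2]; exact hw.2, hne, by rw [h1]; exact e⟩
  refine ⟨L, g1.trans h4, g2, ?_⟩
  have := nT_le X
  have : nM X ^ 2 ≤ k ^ 2 := Nat.pow_le_pow_left h3 2
  omega

end comb

end GWaux

namespace GWaux

section bridge
open GriffithsWords GriffithsWords.Word
open scoped Classical

variable {ι : Type}

def lt (W : Word ι) (q : ℚ) : (ι × ℕ) × Bool :=
  (((W.letter q).1, (W.letter q).2.1), (W.letter q).2.2)

def col (W : Word ι) (q : ℚ) : ι := (W.letter q).1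

def lev (W : Word ι) (q : ℚ) : ℕ := (W.letter q).2.1

def P (W : Word ι) (l : List ℚ) : FreeGroup (ι × ℕ) := FreeGroup.mk (l.map (lt W))

lemma trunc_eq (W : Word ι) (N : ℕ) : W.trunc N = P W (W.truncList N) := rfl

@[simp] lemma P_nil (W : Word ι) : P W [] = 1 := rfl
@[simp] lemma P_append (W : Word ι) (l m : List ℚ) : P W (l ++ m) = P W l * P W m := by
  simp [P, FreeGroup.mul_mk]
lemma P_cons (W : Word ι) (a : ℚ) (m : List ℚ) : P W (a :: m) = P W [a] * P W m := by
  rw [← P_append]; rfl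

def phi : FreeGroup (ι × ℕ) →* Monoid.CoprodI (fun _ : ι => FreeGroup ℕ) :=
  FreeGroup.lift (fun a => lof (a.1, FreeGroup.of a.2))

def psi : Monoid.CoprodI (fun _ : ι => FreeGroup ℕ) →* FreeGroup (ι × ℕ) :=
  Monoid.CoprodI.lift (fun α => FreeGroup.map (fun n => (α, n)))

lemma psi_phi (x : FreeGroup (ι × ℕ)) : psi (phi x) = x := by
  have : (psi.comp phi : FreeGroup (ι × ℕ) →* _) = MonoidHom.id _ := by
    ext a
    simp [phi, psi, lof]
  exact DFunLike.congr_fun this x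

def gs (W : Word ι) (l : List ℚ) : FreeGroup ℕ :=
  FreeGroup.mk (l.map fun q => ((W.letter q).2.1, (W.letter q).2.2))

lemma phi_pure (W : Word ι) (α : ι) (l : List ℚ) (h : ∀ q ∈ l, col W q = α) :
    phi (P W l) = lof (α, gs W l) := by
  have h1 : P W l = FreeGroup.map (fun n => (α, n)) (gs W l) := by
    simp only [P, gs, FreeGroup.map.mk, List.map_map]
    congr 1
    apply List.map_congr_left
    intro q hq
    simp [lt, ← h q hq, col]
  have h2 : (phi.comp (FreeGroup.map (fun n => (α, n))) : FreeGroup ℕ →* _) =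
      Monoid.CoprodI.of (M := fun _ : ι => FreeGroup ℕ) (i := α) := by
    ext n
    simp [phi, lof]
  rw [h1]
  exact DFunLike.congr_fun h2 (gs W l)

inductive R (W : Word ι) : List ℚ → List ℚ → Prop
  | nil (g) (h : P W g = 1) : R W g []
  | cons (g a) {t s} (h : P W g = 1) (H : R W t s) : R W (g ++ a :: t) (a :: s)

lemma R.prepend {W : Word ι} {t s g} (h : P W g = 1) (H : R W t s) : R W (g ++ t) s := by
  cases H with
  | nil g' h' => exact .nil _ (by simp [h, h'])
  | cons g' a h' H =>
    rw [← List.append_assoc]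
    exact .cons _ a (by simp [h, h']) H

lemma R.sublist {W : Word ι} {t s} (H : R W t s) : s.Sublist t := by
  induction H with
  | nil g h => simp
  | cons g a h H ih =>
    exact (ih.cons_cons a).trans (List.sublist_append_right _ _)

lemma R.P_eq {W : Word ι} {t s} (H : R W t s) : P W t = P W s := by
  induction H with
  | nil g h => simp [h]
  | @cons g a t s h H ih => rw [P_append, P_cons W a t, P_cons W a s, h, ih, one_mul]

lemma R.cover {W : Word ι} {t s} (H : R W t s) (q) (hq : q ∈ t) (hs : q ∉ s) :
    ∃ l g m, t = l ++ g ++ m ∧ q ∈ g ∧ P W g = 1 := by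
  induction H with
  | nil g h => exact ⟨[], g, [], by simp, hq, h⟩
  | @cons g a t s h H ih =>
    by_cases hg : q ∈ g
    · exact ⟨[], g, a :: t, by simp, hg, h⟩
    · have hqa : q ≠ a := by rintro rfl; simp at hs
      have hqt : q ∈ t := by simpa [hg, hqa] using hq
      obtain ⟨l, g', m, rfl, h1, h2⟩ := ih hqt (fun h => hs (List.mem_cons_of_mem _ h))
      exact ⟨g ++ a :: l, g', m, by simp, h1, h2⟩

lemma R.exists (W : Word ι) (t : List ℚ) : ∃ s, R W t s ∧ FreeGroup.IsReduced (s.map (lt W)) := by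
  induction t with
  | nil => exact ⟨[], .nil [] rfl, by simp⟩
  | cons a t ih =>
    obtain ⟨s, H, hs⟩ := ih
    cases H with
    | nil g h => exact ⟨[a], .cons [] a rfl (.nil _ h), by simp⟩
    | @cons g b t s h H =>
      by_cases hab : (lt W a).1 = (lt W b).1 → (lt W a).2 = (lt W b).2
      · refine ⟨a :: b :: s, .cons [] a rfl (.cons g b h H), ?_⟩
        simp only [List.map_cons] at hs ⊢
        rw [FreeGroup.isReduced_cons_cons]
        exact ⟨hab, hs⟩
      · refine ⟨s, ?_, ?_⟩
        · have : a :: (g ++ b :: t) = (a :: g ++ [b]) ++ t := by simp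
          rw [this]
          refine R.prepend ?_ H
          rw [P_append, P_cons, h, mul_one, ← P_append]
          push Not at hab
          obtain ⟨h1, h2⟩ := hab
          simp only [P, List.map_append, List.map_cons, List.map_nil, List.cons_append,
            List.nil_append]
          rcases hx : lt W a with ⟨x, u⟩
          rcases hy : lt W b with ⟨y, v⟩
          rw [hx, hy] at h1 h2
          simp only at h1 h2
          subst h1
          have : v = !u := by cases u <;> cases v <;> simp_all
          subst this
          have := FreeGroup.Red.exact.2 ⟨[], .single (FreeGroup.Red.Step.not (L₁ := []) (L₂ := []) (x := x) (b := u)), .refl⟩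
          exact this
        · exact List.IsChain.tail hs

lemma nil_of_reduced {W : Word ι} {l : List ℚ} (h : FreeGroup.IsReduced (l.map (lt W)))
    (h1 : P W l = 1) : l = [] := by
  have := h.reduce_eq
  have h2 : FreeGroup.toWord (P W l) = [] := by rw [h1]; simp
  rw [P, FreeGroup.toWord_mk, this] at h2
  simpa using h2

lemma chunks (W : Word ι) (S : List ℚ) : ∃ C : List (ι × List ℚ),
    (C.map Prod.snd).flatten = S ∧ (∀ c ∈ C, c.2 ≠ [] ∧ ∀ q ∈ c.2, col W q = c.1) ∧
    (C.map Prod.fst).IsChain (· ≠ ·) := by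
  induction S with
  | nil => exact ⟨[], by simp⟩
  | cons a S ih =>
    obtain ⟨C, h1, h2, h3⟩ := ih
    cases C with
    | nil =>
      refine ⟨[(col W a, [a])], ?_, ?_, ?_⟩ <;> simp_all
    | cons c C =>
      by_cases hc : c.1 = col W a
      · refine ⟨(c.1, a :: c.2) :: C, ?_, ?_, ?_⟩
        · simpa using h1
        · intro d hd
          rcases List.mem_cons.1 hd with rfl | hd
          · refine ⟨by simp, ?_⟩
            intro q hq
            rcases List.mem_cons.1 hq with rfl | hq
            · exact hc.symm
            · exact (h2 c (by simp)).2 q hq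
          · exact h2 d (by simp [hd])
        · simpa using h3
      · refine ⟨(col W a, [a]) :: c :: C, ?_, ?_, ?_⟩
        · simpa using h1
        · intro d hd
          rcases List.mem_cons.1 hd with rfl | hd
          · simp
          · exact h2 d hd
        · simp only [List.map_cons, List.isChain_cons_cons] at h3 ⊢
          exact ⟨fun h => hc h.symm, h3⟩

def cl (W : Word ι) (c : ι × List ℚ) : ι × FreeGroup ℕ := (c.1, gs W c.2)

lemma ev_chunks (W : Word ι) (C : List (ι × List ℚ)) (h : ∀ c ∈ C, ∀ q ∈ c.2, col W q = c.1) :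
    ev (C.map (cl W)) = phi (P W (C.map Prod.snd).flatten) := by
  induction C with
  | nil => simp
  | cons c C ih =>
    simp only [List.map_cons, ev_cons, List.flatten_cons, P_append, map_mul]
    rw [ih (fun d hd => h d (by simp [hd])), phi_pure W c.1 c.2 (h c (by simp))]
    rfl

lemma deleted {C' C : List (ι × List ℚ)} (h : C'.Sublist C)
    (hn : (C.map Prod.snd).flatten.Nodup) :
    ∃ D : List (ι × List ℚ), (∀ c ∈ D, c ∈ C) ∧ D.length + C'.length = C.length ∧
      (C'.map Prod.snd).flatten =
        (C.map Prod.snd).flatten.filter (fun q => ∀ c ∈ D, q ∉ c.2) := by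
  induction h with
  | slnil => exact ⟨[], by simp⟩
  | @cons C' C c h ih =>
    simp only [List.map_cons, List.flatten_cons, List.nodup_append] at hn
    obtain ⟨D, h1, h2, h3⟩ := ih hn.2.1
    refine ⟨c :: D, ?_, by simp; omega, ?_⟩
    · intro d hd
      rcases List.mem_cons.1 hd with rfl | hd
      · simp
      · simp [h1 d hd]
    · rw [h3, List.map_cons, List.flatten_cons, List.filter_append]
      have e1 : c.2.filter (fun q => decide (∀ d ∈ c :: D, q ∉ d.2)) = [] := by
        rw [List.filter_eq_nil_iff]
        intro q hq
        simp [hq]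
      rw [e1, List.nil_append]
      apply List.filter_congr
      intro q hq
      have : q ∉ c.2 := fun hc => hn.2.2 q hc q hq rfl
      simp [this]
  | @cons_cons C' C c h ih =>
    simp only [List.map_cons, List.flatten_cons, List.nodup_append] at hn
    obtain ⟨D, h1, h2, h3⟩ := ih hn.2.1
    refine ⟨D, ?_, by simp; omega, ?_⟩
    · intro d hd
      simp [h1 d hd]
    · simp only [List.map_cons, List.flatten_cons, List.filter_append, h3]
      congr 1
      symm
      rw [List.filter_eq_self]
      intro q hq
      simp only [decide_eq_true_eq]
      intro d hd hqd
      refine hn.2.2 q hq q ?_ rfl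
      exact List.mem_flatten.2 ⟨d.2, List.mem_map.2 ⟨d, h1 d hd, rfl⟩, hqd⟩

lemma truncList_sorted (W : Word ι) (N) : (W.truncList N).Pairwise (· < ·) := by
  have h1 : (W.truncList N).Pairwise (· ≤ ·) := Finset.pairwise_sort _ _
  have h2 : (W.truncList N).Nodup := Finset.sort_nodup _ _
  exact h1.imp₂ (fun a b h h' => lt_of_le_of_ne h h') h2

lemma mem_truncList (W : Word ι) (N q) : q ∈ W.truncList N ↔ q ∈ W.dom ∧ lev W q ≤ N := by
  simp [truncList, lev]

lemma sorted_ext {l m : List ℚ} (hl : l.Pairwise (· < ·)) (hm : m.Pairwise (· < ·))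
    (h : ∀ q, q ∈ l ↔ q ∈ m) : l = m :=
  List.SortedLT.eq_of_mem_iff hl.sortedLT hm.sortedLT h

lemma trunc_restrict (W : Word ι) (I : Set ℚ) (N) :
    (W.restrict I).trunc N = P W ((W.truncList N).filter (· ∈ I)) := by
  have : (W.restrict I).truncList N = (W.truncList N).filter (· ∈ I) := by
    apply sorted_ext (truncList_sorted _ _) ((truncList_sorted W N).filter _)
    intro q
    simp only [mem_truncList, List.mem_filter, restrict, lev, decide_eq_true_eq, Set.mem_inter_iff]
    tauto
  rw [trunc_eq, this]; rfl

def proj (M : ℕ) : FreeGroup (ι × ℕ) →* FreeGroup (ι × ℕ) :=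
  FreeGroup.lift (fun a => if a.2 ≤ M then FreeGroup.of a else 1)

lemma proj_P (W : Word ι) (M : ℕ) (l : List ℚ) :
    proj M (P W l) = P W (l.filter (lev W · ≤ M)) := by
  induction l with
  | nil => simp
  | cons a l ih =>
    rw [P_cons, map_mul, ih]
    have : proj M (P W [a]) = if lev W a ≤ M then P W [a] else 1 := by
      have h : P W [a] = FreeGroup.mk [lt W a] := rfl
      rw [h, proj, FreeGroup.lift_mk]
      by_cases hl : lev W a ≤ M
      · have hl' : (lt W a).1.2 ≤ M := hl
        rw [if_pos hl]
        simp only [List.map_cons, List.map_nil, List.prod_singleton, if_pos hl']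
        obtain ⟨x, u⟩ := lt W a
        cases u <;> simp [FreeGroup.of, FreeGroup.inv_mk, FreeGroup.invRev]
      · have hl' : ¬ (lt W a).1.2 ≤ M := hl
        rw [if_neg hl]
        simp [if_neg hl']
    rw [this]
    by_cases hl : lev W a ≤ M
    · rw [if_pos hl, List.filter_cons_of_pos (by simpa using hl)]
      exact (P_cons W a _).symm
    · rw [if_neg hl, List.filter_cons_of_neg (by simpa using hl), one_mul]

lemma level (W : Word ι) (N k : ℕ) (H : Nm k (phi (W.trunc N))) :
    ∃ (S : List ℚ) (J : Fin (2 * k ^ 2 + 3 * k) → Set ℚ), S.Sublist (W.truncList N) ∧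
      (∀ q ∈ W.truncList N, q ∉ S → ∃ K : Set ℚ, K.OrdConnected ∧ q ∈ K ∧
        P W ((W.truncList N).filter (· ∈ K)) = 1) ∧
      (∀ j, ∀ a ∈ J j, ∀ c ∈ J j, ∀ b ∈ S, a ≤ b → b ≤ c → b ∈ J j) ∧
      (∀ j, ∀ a ∈ J j, ∀ c ∈ J j, col W a = col W c) ∧
      P W (S.filter (fun q => ∀ j, q ∉ J j)) = 1 := by
  obtain ⟨S, hR, hred⟩ := R.exists W (W.truncList N)
  obtain ⟨C, hC1, hC2, hC3⟩ := chunks W S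
  have hsort := (truncList_sorted W N).sublist hR.sublist
  have hnorm : Normal (C.map (cl W)) := by
    refine ⟨?_, ?_⟩
    · intro a ha h1
      obtain ⟨c, hc, rfl⟩ := List.mem_map.1 ha
      have h2 := phi_pure W c.1 c.2 (hC2 c hc).2
      simp only [cl] at h1
      rw [h1, lof_one] at h2
      have h3 : P W c.2 = 1 := by rw [← psi_phi (P W c.2), h2, map_one]
      refine (hC2 c hc).1 (nil_of_reduced (W := W) ?_ h3)
      obtain ⟨A, B, rfl⟩ := List.append_of_mem hc
      have h4 : S.map (lt W) = (A.map Prod.snd).flatten.map (lt W) ++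
          (c.2.map (lt W) ++ (B.map Prod.snd).flatten.map (lt W)) := by
        rw [← hC1]; simp
      rw [h4] at hred
      exact List.IsChain.left_of_append (List.IsChain.right_of_append hred)
    · simpa [cl, Function.comp_def] using hC3
  have hev : ev (C.map (cl W)) = phi (W.trunc N) := by
    rw [ev_chunks W C (fun c hc => (hC2 c hc).2), hC1, ← hR.P_eq]; rfl
  rw [← hev] at H
  obtain ⟨L, hL1, hL2, hL3⟩ := finite_main hnorm H
  obtain ⟨C', hC', rfl⟩ := List.sublist_map_iff.1 hL1
  obtain ⟨D, hD1, hD2, hD3⟩ := deleted hC' (by rw [hC1]; exact hsort.imp (fun h => ne_of_lt h))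
  have hlen : D.length ≤ 2 * k ^ 2 + 3 * k := by simp at hL3; omega
  have hJ : ∀ q, (∀ j : Fin (2 * k ^ 2 + 3 * k), ¬ ∃ c, D[j.1]? = some c ∧ q ∈ c.2) ↔
      ∀ c ∈ D, q ∉ c.2 := by
    intro q
    constructor
    · intro h c hc hq
      obtain ⟨i, hi, rfl⟩ := List.mem_iff_getElem.1 hc
      exact h ⟨i, by omega⟩ ⟨_, by simp [hi], hq⟩
    · rintro h j ⟨c, hc, hq⟩
      exact h c (List.mem_of_getElem? hc) hq
  refine ⟨S, fun j => {q | ∃ c, D[j.1]? = some c ∧ q ∈ c.2}, hR.sublist, ?_, ?_, ?_, ?_⟩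
  · intro q hq hqS
    obtain ⟨l, g, m, he, hqg, hP⟩ := hR.cover q hq hqS
    refine ⟨{x | ∃ a ∈ g, ∃ b ∈ g, a ≤ x ∧ x ≤ b}, ?_, ⟨q, hqg, q, hqg, le_rfl, le_rfl⟩, ?_⟩
    · constructor
      rintro x ⟨a, ha, b, hb, h1, h2⟩ y ⟨a', ha', b', hb', h1', h2'⟩ z ⟨hz1, hz2⟩
      exact ⟨a, ha, b', hb', h1.trans hz1, hz2.trans h2'⟩
    · have hs := truncList_sorted W N
      rw [he] at hs ⊢
      rw [List.append_assoc, List.pairwise_append, List.pairwise_append] at hs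
      obtain ⟨-, ⟨-, -, hs2⟩, hs1⟩ := hs
      rw [List.filter_append, List.filter_append, List.filter_eq_nil_iff.2,
        List.filter_eq_self.2, List.filter_eq_nil_iff.2]
      · simpa using hP
      · intro x hx
        simp only [Set.mem_setOf_eq, decide_eq_true_eq]
        rintro ⟨a, ha, b, hb, h1, h2⟩
        exact absurd (hs2 b hb x hx) (not_lt.2 h2)
      · intro x hx
        simp only [Set.mem_setOf_eq, decide_eq_true_eq]
        exact ⟨x, hx, x, hx, le_rfl, le_rfl⟩
      · intro x hx
        simp only [Set.mem_setOf_eq, decide_eq_true_eq]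
        rintro ⟨a, ha, b, hb, h1, h2⟩
        exact absurd (hs1 x hx a (by simp [ha])) (not_lt.2 h1)
  · rintro j a ⟨c, hc, ha⟩ e ⟨c', hc', he⟩ b hb hab hbe
    rw [hc] at hc'
    obtain rfl : c = c' := by simpa using hc'
    refine ⟨c, hc, ?_⟩
    obtain ⟨A, B, rfl⟩ := List.append_of_mem (hD1 c (List.mem_of_getElem? hc))
    rw [← hC1] at hsort hb
    simp only [List.map_append, List.map_cons, List.flatten_append, List.flatten_cons] at hsort hb
    rw [List.pairwise_append, List.pairwise_append] at hsort
    obtain ⟨-, ⟨-, -, hs2⟩, hs1⟩ := hsort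
    rcases List.mem_append.1 hb with hb | hb
    · exact absurd (hs1 b hb a (List.mem_append_left _ ha)) (not_lt.2 hab)
    · rcases List.mem_append.1 hb with hb | hb
      · exact hb
      · exact absurd (hs2 e he b hb) (not_lt.2 hbe)
  · rintro j a ⟨c, hc, ha⟩ e ⟨c', hc', he⟩
    rw [hc] at hc'
    obtain rfl : c = c' := by simpa using hc'
    have := (hC2 c (hD1 c (List.mem_of_getElem? hc))).2
    rw [this a ha, this e he]
  · have e1 : S.filter (fun q => decide (∀ j : Fin (2 * k ^ 2 + 3 * k),
        q ∉ {q | ∃ c, D[j.1]? = some c ∧ q ∈ c.2})) = (C'.map Prod.snd).flatten := by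
      rw [hD3, hC1]
      apply List.filter_congr
      intro q _
      rw [decide_eq_decide]
      exact hJ q
    suffices h : P W (C'.map Prod.snd).flatten = 1 by
      rw [← e1] at h
      convert h
    rw [ev_chunks W C' (fun c hc => (hC2 c (hC'.subset hc)).2)] at hL2
    rw [← psi_phi (P W _), hL2, map_one]

lemma filter_lev (W : Word ι) {M N : ℕ} (h : M ≤ N) (p : ℚ → Prop) :
    ((W.truncList N).filter (fun q => decide (p q))).filter (fun q => decide (lev W q ≤ M)) =
      (W.truncList M).filter (fun q => decide (p q)) := by
  apply sorted_ext (((truncList_sorted _ _).filter _).filter _) ((truncList_sorted _ _).filter _)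
  intro q
  simp only [mem_truncList, List.mem_filter, decide_eq_true_eq]
  constructor
  · rintro ⟨⟨⟨h1, h2⟩, h3⟩, h4⟩; exact ⟨⟨h1, h4⟩, h3⟩
  · rintro ⟨⟨h1, h4⟩, h3⟩; exact ⟨⟨⟨h1, h4.trans h⟩, h3⟩, h4⟩

theorem forward (W : Word ι) (hW : W.Reduced) (k : ℕ) (H : ∀ N, Nm k (phi (W.trunc N))) :
    ∃ (p : ℕ) (I : Fin p → Set ℚ),
        (∀ j, W.IsIntervalIn (I j) ∧ (W.restrict (I j)).IsPure) ∧
        (W.restrict (W.dom \ ⋃ j, I j)).SimE := by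
  choose S J hS hK hconv hcol hP using fun N => level W N k (H N)
  let U : Ultrafilter ℕ := Filter.hyperfilter ℕ
  have hU : ∀ M, ∀ᶠ N in (U : Filter ℕ), M ≤ N := by
    intro M
    exact (Nat.hyperfilter_le_atTop (Filter.eventually_ge_atTop M))
  -- survival
  have hsurv : ∀ q ∈ W.dom, ∀ᶠ N in (U : Filter ℕ), q ∈ S N := by
    intro q hq
    by_contra hc
    rw [← Ultrafilter.eventually_not] at hc
    have hex : ∀ N, ∃ K : Set ℚ, K.OrdConnected ∧ (lev W q ≤ N → q ∉ S N → q ∈ K ∧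
        P W ((W.truncList N).filter (· ∈ K)) = 1) := by
      intro N
      by_cases h : lev W q ≤ N ∧ q ∉ S N
      · obtain ⟨K, h1, h2⟩ := hK N q ((mem_truncList _ _ _).2 ⟨hq, h.1⟩) h.2
        exact ⟨K, h1, fun _ _ => h2⟩
      · exact ⟨∅, Set.ordConnected_empty, fun a b => absurd ⟨a, b⟩ h⟩
    choose K hK1 hK2 using hex
    have hev : ∀ᶠ N in (U : Filter ℕ), q ∈ K N ∧ P W ((W.truncList N).filter (· ∈ K N)) = 1 := by
      filter_upwards [hc, hU (lev W q)] with N h1 h2 using hK2 N h2 h1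
    have := hW {x | x ∈ W.dom ∧ ∀ᶠ N in (U : Filter ℕ), x ∈ K N} ⟨fun x hx => hx.1, ?_⟩ ?_
    · have hq' : q ∈ {x | x ∈ W.dom ∧ ∀ᶠ N in (U : Filter ℕ), x ∈ K N} :=
        ⟨hq, hev.mono fun N h => h.1⟩
      rw [this] at hq'
      exact hq'
    · rintro a ⟨ha, ha'⟩ c ⟨hc, hc'⟩ b hb hab hbc
      refine ⟨hb, ?_⟩
      filter_upwards [ha', hc'] with N h1 h2 using (hK1 N).out h1 h2 ⟨hab, hbc⟩
    · intro M
      rw [trunc_restrict]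
      have h1 : ∀ᶠ N in (U : Filter ℕ), ∀ x ∈ (W.truncList M).toFinset,
          ((∀ᶠ N in (U : Filter ℕ), x ∈ K N) ↔ x ∈ K N) := by
        rw [Filter.eventually_all_finset]
        intro x _
        by_cases h : ∀ᶠ N in (U : Filter ℕ), x ∈ K N
        · filter_upwards [h] with N hN; simp [h, hN]
        · have h' := h
          rw [← Ultrafilter.eventually_not] at h'
          filter_upwards [h'] with N hN; simp [h, hN]
      obtain ⟨N, hN1, hN2, hN3⟩ := (h1.and (hev.and (hU M))).exists
      have h2 := congrArg (proj M) hN2.2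
      rw [proj_P, map_one, filter_lev W hN3 (· ∈ K N)] at h2
      rw [← h2]
      congr 1
      apply List.filter_congr
      intro x hx
      rw [decide_eq_decide, ← hN1 x (by simpa using hx)]
      have := ((mem_truncList W M x).1 hx).1
      simp [this]
  let I : Fin (2 * k ^ 2 + 3 * k) → Set ℚ :=
    fun j => {q | q ∈ W.dom ∧ ∀ᶠ N in (U : Filter ℕ), q ∈ J N j}
  refine ⟨_, I, ?_, ?_⟩
  · intro j
    refine ⟨⟨fun x hx => hx.1, ?_⟩, ?_⟩
    · rintro a ⟨ha, ha'⟩ c ⟨hc, hc'⟩ b hb hab hbc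
      refine ⟨hb, ?_⟩
      filter_upwards [ha', hc', hsurv b hb] with N h1 h2 h3 using hconv N j a h1 c h2 b h3 hab hbc
    · by_cases hne : ∃ q, q ∈ I j
      · obtain ⟨q, hq⟩ := hne
        refine ⟨col W q, ?_⟩
        rintro x ⟨-, hx⟩
        obtain ⟨N, h1, h2⟩ := (hx.2.and hq.2).exists
        exact hcol N j x h1 q h2
      · refine ⟨col W 0, ?_⟩
        rintro x ⟨-, hx⟩
        exact absurd ⟨x, hx⟩ hne
  · intro M
    rw [trunc_restrict]
    have h1 : ∀ᶠ N in (U : Filter ℕ), ∀ x ∈ (W.truncList M).toFinset,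
        ((∀ j, x ∉ I j) ↔ (∀ j, x ∉ J N j)) ∧ x ∈ S N := by
      rw [Filter.eventually_all_finset]
      intro x hx
      have hxd : x ∈ W.dom := ((mem_truncList W M x).1 (by simpa using hx)).1
      have h2 : ∀ᶠ N in (U : Filter ℕ), ∀ j, (x ∈ I j ↔ x ∈ J N j) := by
        rw [Filter.eventually_all]
        intro j
        by_cases h : ∀ᶠ N in (U : Filter ℕ), x ∈ J N j
        · filter_upwards [h] with N hN
          exact ⟨fun _ => hN, fun _ => ⟨hxd, h⟩⟩
        · have h' := h
          rw [← Ultrafilter.eventually_not] at h'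
          filter_upwards [h'] with N hN
          exact ⟨fun a => absurd a.2 h, fun a => absurd a hN⟩
      filter_upwards [h2, hsurv x hxd] with N h3 h4
      refine ⟨?_, h4⟩
      simp [h3]
    obtain ⟨N, hN1, hN3⟩ := (h1.and (hU M)).exists
    have h2 := congrArg (proj M) (hP N)
    rw [proj_P, map_one] at h2
    rw [← h2]
    congr 1
    have hSs := (truncList_sorted W N).sublist (hS N)
    apply sorted_ext ((truncList_sorted _ _).filter _) ((hSs.filter _).filter _)
    intro q
    simp only [List.mem_filter, decide_eq_true_eq, Set.mem_diff, Set.mem_iUnion, not_exists]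
    constructor
    · rintro ⟨h3, h4, h5⟩
      have := hN1 q (by simpa using h3)
      exact ⟨⟨this.2, this.1.1 h5⟩, ((mem_truncList _ _ _).1 h3).2⟩
    · rintro ⟨⟨h3, h4⟩, h5⟩
      have hd := ((mem_truncList _ _ _).1 ((hS N).subset h3)).1
      have hm : q ∈ W.truncList M := (mem_truncList _ _ _).2 ⟨hd, h5⟩
      exact ⟨hm, hd, (hN1 q (by simpa using hm)).1.2 h4⟩

lemma nm_of_mem (g : wordGroup ι) (hg : g ∈ Subgroup.normalClosure (pureClasses ι)) :
    ∃ k, ∀ N, Nm k (phi ((g : (N : ℕ) → FreeGroup (ι × ℕ)) N)) := by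
  unfold Subgroup.normalClosure at hg
  induction hg using Subgroup.closure_induction with
  | mem x hx =>
    obtain ⟨a, ⟨V, -, ⟨α, hα⟩, hV⟩, hc⟩ := Group.mem_conjugatesOfSet_iff.1 hx
    obtain ⟨c, rfl⟩ := isConj_iff.1 hc
    refine ⟨1, fun N => ?_⟩
    have h1 : (a : (N : ℕ) → FreeGroup (ι × ℕ)) N = P V (V.truncList N) := by
      rw [← hV]; rfl
    have h2 := phi_pure V α (V.truncList N) (fun q hq => hα q ((mem_truncList _ _ _).1 hq).1)
    simp only [Subgroup.coe_mul, Subgroup.coe_inv, Pi.mul_apply, Pi.inv_apply, map_mul, map_inv,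
      h1, h2]
    exact Nm.conj _ _ _
  | one => exact ⟨0, fun N => by simpa using Nm.one⟩
  | mul x y hx hy ihx ihy =>
    obtain ⟨k, hk⟩ := ihx
    obtain ⟨l, hl⟩ := ihy
    exact ⟨k + l, fun N => by simpa using (hk N).mul (hl N)⟩
  | inv x hx ih =>
    obtain ⟨k, hk⟩ := ih
    exact ⟨k, fun N => by simpa using (hk N).inv⟩

lemma coneClass_eq_one_iff (W : Word ι) : coneClass W = 1 ↔
    (⟨W.Phi, Phi_mem_wordGroup W⟩ : wordGroup ι) ∈ Subgroup.normalClosure (pureClasses ι) :=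
  QuotientGroup.eq_one_iff _

lemma coneClass_congr {W V : Word ι} (h : ∀ N, W.trunc N = V.trunc N) :
    coneClass W = coneClass V := by
  have : W.Phi = V.Phi := funext h
  unfold coneClass
  congr 2

lemma coneClass_mul {W V X : Word ι} (h : ∀ N, X.trunc N = W.trunc N * V.trunc N) :
    coneClass X = coneClass W * coneClass V := by
  have h1 : (⟨X.Phi, Phi_mem_wordGroup X⟩ : wordGroup ι) =
      ⟨W.Phi, Phi_mem_wordGroup W⟩ * ⟨V.Phi, Phi_mem_wordGroup V⟩ :=
    Subtype.ext (funext h)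
  unfold coneClass
  rw [h1]
  rfl

lemma coneClass_union (W : Word ι) (A B K : Set ℚ) (hK : K = A ∪ B)
    (hAB : ∀ a ∈ A, ∀ b ∈ B, a < b) :
    coneClass (W.restrict K) = coneClass (W.restrict A) * coneClass (W.restrict B) := by
  apply coneClass_mul
  intro N
  rw [trunc_restrict, trunc_restrict, trunc_restrict, ← P_append]
  congr 1
  apply sorted_ext ((truncList_sorted _ _).filter _)
  · rw [List.pairwise_append]
    refine ⟨(truncList_sorted _ _).filter _, (truncList_sorted _ _).filter _, ?_⟩
    intro a ha b hb
    simp only [List.mem_filter, decide_eq_true_eq] at ha hb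
    exact hAB a ha.2 b hb.2
  · intro q
    simp only [List.mem_filter, decide_eq_true_eq, List.mem_append, hK, Set.mem_union]
    tauto

lemma coneClass_pure (W : Word ι) (hW : W.Reduced) (I : Set ℚ) (hI : W.IsIntervalIn I)
    (hp : (W.restrict I).IsPure) : coneClass (W.restrict I) = 1 := by
  rw [coneClass_eq_one_iff]
  apply Subgroup.subset_normalClosure
  refine ⟨W.restrict I, ?_, hp, rfl⟩
  intro K hK hE
  have hKI : K ⊆ I := fun x hx => (hK.1 hx).2
  refine hW K ⟨fun x hx => hI.1 (hKI hx), ?_⟩ ?_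
  · intro a ha c hc b hb hab hbc
    exact hK.2 a ha c hc b ⟨hb, hI.2 a (hKI ha) c (hKI hc) b hb hab hbc⟩ hab hbc
  · intro N
    rw [← hE N, trunc_restrict, trunc_restrict]
    have : (W.restrict I).truncList N = (W.truncList N).filter (· ∈ I) := by
      apply sorted_ext (truncList_sorted _ _) ((truncList_sorted W N).filter _)
      intro q
      simp only [mem_truncList, List.mem_filter, restrict, lev, decide_eq_true_eq,
        Set.mem_inter_iff]
      tauto
    rw [this, List.filter_filter]
    change P W _ = P W _
    congr 1
    apply List.filter_congr
    intro q _
    have := @hKI q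
    by_cases h : q ∈ K <;> simp [h, this]

lemma coneClass_delete (W : Word ι) (hW : W.Reduced) (Is : List (Set ℚ))
    (hIs : ∀ I ∈ Is, W.IsIntervalIn I ∧ (W.restrict I).IsPure) :
    ∀ K, W.IsIntervalIn K →
      coneClass (W.restrict K) = coneClass (W.restrict {q | q ∈ K ∧ ∀ I ∈ Is, q ∉ I}) := by
  induction Is with
  | nil => intro K _; simp
  | cons I Is ih =>
    intro K hK
    have ih := ih (fun J hJ => hIs J (by simp [hJ]))
    obtain ⟨hI, hp⟩ := hIs I (by simp)
    by_cases hne : I = ∅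
    · subst hne
      rw [ih K hK]
      simp
    obtain ⟨i, hi⟩ := Set.nonempty_iff_ne_empty.2 hne
    set A : Set ℚ := {q | q ∈ K ∧ ∀ x ∈ I, q < x} with hA
    set B : Set ℚ := {q | q ∈ K ∧ ∀ x ∈ I, x < q} with hB
    have hcov : ∀ q ∈ K, q ∉ I → q ∈ A ∨ q ∈ B := by
      intro q hq hqI
      rcases lt_trichotomy q i with h | h | h
      · left
        refine ⟨hq, fun x hx => ?_⟩
        by_contra hc
        exact hqI (hI.2 x hx i hi q (hK.1 hq) (not_lt.1 hc) h.le)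
      · exact absurd (h ▸ hi) hqI
      · right
        refine ⟨hq, fun x hx => ?_⟩
        by_contra hc
        exact hqI (hI.2 i hi x hx q (hK.1 hq) h.le (not_lt.1 hc))
    have hAi : W.IsIntervalIn A := ⟨fun x hx => hK.1 hx.1, fun a ha c hc b hb hab hbc =>
      ⟨hK.2 a ha.1 c hc.1 b hb hab hbc, fun x hx => lt_of_le_of_lt hbc (hc.2 x hx)⟩⟩
    have hBi : W.IsIntervalIn B := ⟨fun x hx => hK.1 hx.1, fun a ha c hc b hb hab hbc =>
      ⟨hK.2 a ha.1 c hc.1 b hb hab hbc, fun x hx => lt_of_lt_of_le (ha.2 x hx) hab⟩⟩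
    have hKIi : W.IsIntervalIn (K ∩ I) := ⟨fun x hx => hK.1 hx.1, fun a ha c hc b hb hab hbc =>
      ⟨hK.2 a ha.1 c hc.1 b hb hab hbc, hI.2 a ha.2 c hc.2 b hb hab hbc⟩⟩
    have hKIp : (W.restrict (K ∩ I)).IsPure := by
      obtain ⟨α, h⟩ := hp
      exact ⟨α, fun q hq => h q ⟨hq.1, hq.2.2⟩⟩
    have e1 : coneClass (W.restrict K) = coneClass (W.restrict A) *
        coneClass (W.restrict (K ∩ I ∪ B)) := by
      apply coneClass_union
      · ext q
        constructor
        · intro hq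
          by_cases hqI : q ∈ I
          · exact Or.inr (Or.inl ⟨hq, hqI⟩)
          · rcases hcov q hq hqI with h | h
            · exact Or.inl h
            · exact Or.inr (Or.inr h)
        · rintro (h | h | h)
          · exact h.1
          · exact h.1
          · exact h.1
      · rintro a ha b (hb | hb)
        · exact ha.2 b hb.2
        · exact (ha.2 i hi).trans (hb.2 i hi)
    have e2 := coneClass_union W (K ∩ I) B _ rfl (fun a ha b hb => hb.2 a ha.2)
    rw [e1, e2, coneClass_pure W hW _ hKIi hKIp, one_mul, ih A hAi, ih B hBi]
    symm
    apply coneClass_union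
    · ext q
      simp only [List.mem_cons, forall_eq_or_imp, Set.mem_setOf_eq, Set.mem_union]
      constructor
      · rintro ⟨hq, hqI, h⟩
        rcases hcov q hq hqI with h' | h'
        · exact Or.inl ⟨h', h⟩
        · exact Or.inr ⟨h', h⟩
      · rintro (⟨h', h⟩ | ⟨h', h⟩)
        · exact ⟨h'.1, fun hqI => lt_irrefl _ (h'.2 q hqI), h⟩
        · exact ⟨h'.1, fun hqI => lt_irrefl _ (h'.2 q hqI), h⟩
    · rintro a ⟨ha, -⟩ b ⟨hb, -⟩
      exact (ha.2 i hi).trans (hb.2 i hi)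

theorem backward (W : Word ι) (hW : W.Reduced) (p : ℕ) (I : Fin p → Set ℚ)
    (h : ∀ j, W.IsIntervalIn (I j) ∧ (W.restrict (I j)).IsPure)
    (hE : (W.restrict (W.dom \ ⋃ j, I j)).SimE) : coneClass W = 1 := by
  have h1 := coneClass_delete W hW (List.ofFn I) (by
    intro J hJ
    obtain ⟨j, rfl⟩ := (List.mem_ofFn' _ _).1 hJ
    exact h j) W.dom ⟨fun _ h => h, fun _ _ _ _ b hb _ _ => hb⟩
  have h2 : {q | q ∈ W.dom ∧ ∀ J ∈ List.ofFn I, q ∉ J} = W.dom \ ⋃ j, I j := by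
    ext q
    simp [List.mem_ofFn']
  have h3 : coneClass W = coneClass (W.restrict W.dom) := by
    apply coneClass_congr
    intro N
    rw [trunc_restrict, trunc_eq]
    congr 1
    symm
    rw [List.filter_eq_self]
    intro q hq
    simpa using ((mem_truncList _ _ _).1 hq).1
  rw [h3, h1, h2, coneClass_eq_one_iff]
  have : (⟨(W.restrict (W.dom \ ⋃ j, I j)).Phi, Phi_mem_wordGroup _⟩ : wordGroup ι) = 1 :=
    Subtype.ext (funext hE)
  rw [this]
  exact one_mem _

end bridge

end GWaux

open GriffithsWords GriffithsWords.Word in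
/-- **Corollary.** A reduced word `W ∈ Red_κ` lies in the kernel of the quotient map
`Red_κ → 𝒞_κ` (i.e. `[[W]] = 1`) if and only if there are finitely many intervals
`I₀, …, I_p` of its domain such that each restriction `W ↾ I_j` is pure and the restriction
of `W` to the complement of their union reduces to the empty word (equivalently, is `∼ E`). -/
theorem mem_kernel_iff_delete_finitely_many_pure_intervals
    (ι : Type) (W : Word ι) (hW : W.Reduced) :
    coneClass W = 1 ↔
      ∃ (p : ℕ) (I : Fin p → Set ℚ),
        (∀ j, W.IsIntervalIn (I j) ∧ (W.restrict (I j)).IsPure) ∧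
        (W.restrict (W.dom \ ⋃ j, I j)).SimE := by
  constructor
  · intro h
    obtain ⟨k, hk⟩ := GWaux.nm_of_mem _ ((GWaux.coneClass_eq_one_iff W).1 h)
    exact GWaux.forward W hW k hk
  · rintro ⟨p, I, h, hE⟩
    exact GWaux.backward W hW p I h hE
end
end

section
/- Let κ be a cardinal and suppose V ∈ Red_κ with V ≡ ∏_{n∈ω} V_n such that: (1) every interval I ⊆ V̄ for which V↾I is pure is contained in the domain of ∏_{n=0}^{m} V_n for some m ∈ ω; and (2) for each n ∈ ω there exists j_n ∈ ω such that the number of positions i in the domain of V_n with proj₁(V_n(i)) = j_n is strictly greater than the total number of positions i in the domains of all V_m with m ≠ n satisfying proj₁(V_m(i)) = j_n. Then [[V]] ≠ [[E]] in the cone group 𝒞_κ. -/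
noncomputable section

namespace ConeProof

set_option linter.all false

def NC (l : List ℕ) : Prop := ∀ (i j k m a b : ℕ), i < j → j < k → k < m →
  l[i]? = some a → l[k]? = some a → l[j]? = some b → l[m]? = some b → a = b

def ren (k k' c : ℕ) : ℕ := if c = k ∨ c = k' then min k k' else c

lemma nc_core1 (F : ℕ → Option ℕ) (s σ τ : ℕ) (hσ : σ = s ∨ σ = s + 1) (hτ : τ = s ∨ τ = s + 1)
   (h : ∀ i j k m a b, i < j → j < k → k < m →
  F i = some a → F k = some a → F j = some b → F m = some b → a = b)
   (p q r t a b c : ℕ) (h1 : p < q) (h2 : q < r) (h3 : r < t)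
   (np : p ≠ s ∧ p ≠ s+1) (nq : q ≠ s ∧ q ≠ s+1) (nr : r ≠ s ∧ r ≠ s+1) (nt : t ≠ s ∧ t ≠ s+1)
   (hab : a ≠ b) (hcb : c ≠ b)
   (hp : F p = some a) (hq : F q = some b) (hr : F r = some c) (ht : F t = some b)
   (hs : F σ = some a) (hs' : F τ = some c) : False := by
  by_cases c1 : s < q
  · exact hcb (h τ q r t c b (by omega) h2 h3 hs' hr hq ht)
  · by_cases c2 : s < t
    · exact hab (h p q σ t a b h1 (by omega) (by omega) hp hs hq ht)
    · exact hcb (h q r t τ b c h2 h3 (by omega) hq ht hr hs').symm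

lemma nc_core2 (F : ℕ → Option ℕ) (s σ τ : ℕ) (hσ : σ = s ∨ σ = s + 1) (hτ : τ = s ∨ τ = s + 1)
   (h : ∀ i j k m a b, i < j → j < k → k < m →
  F i = some a → F k = some a → F j = some b → F m = some b → a = b)
   (p q r t a b d : ℕ) (h1 : p < q) (h2 : q < r) (h3 : r < t)
   (np : p ≠ s ∧ p ≠ s+1) (nq : q ≠ s ∧ q ≠ s+1) (nr : r ≠ s ∧ r ≠ s+1) (nt : t ≠ s ∧ t ≠ s+1)
   (hab : a ≠ b) (had : a ≠ d)
   (hp : F p = some a) (hq : F q = some b) (hr : F r = some a) (ht : F t = some d)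
   (hs : F σ = some b) (hs' : F τ = some d) : False := by
  by_cases c1 : s < p
  · exact hab (h σ p q r b a (by omega) h1 h2 hs hq hp hr).symm
  · by_cases c2 : s < r
    · exact had (h p τ r t a d (by omega) (by omega) h3 hp hr hs' ht)
    · exact hab (h p q r σ a b h1 h2 (by omega) hp hr hq hs)

lemma nc_merge_aux (F : ℕ → Option ℕ) (s k k' : ℕ) (hs : F s = some k) (hs' : F (s+1) = some k')
   (h : ∀ (i j k m a b : ℕ), i < j → j < k → k < m →
  F i = some a → F k = some a → F j = some b → F m = some b → a = b)
   (p q r t a b c d : ℕ) (h1 : p < q) (h2 : q < r) (h3 : r < t) 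
   (np : p ≠ s ∧ p ≠ s+1) (nq : q ≠ s ∧ q ≠ s+1) (nr : r ≠ s ∧ r ≠ s+1) (nt : t ≠ s ∧ t ≠ s+1)
   (hp : F p = some a) (hq : F q = some b) (hr : F r = some c) (ht : F t = some d)
   (hac : ren k k' a = ren k k' c) (hbd : ren k k' b = ren k k' d) : ren k k' a = ren k k' b := by
  have key : ∀ x y, ren k k' x = ren k k' y → x = y ∨ (x = k ∧ y = k') ∨ (x = k' ∧ y = k) := by
    intro x y; unfold ren; split_ifs <;> omega
  by_cases hab : ren k k' a = ren k k' b
  · exact hab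
  exfalso
  have e1 : ren k k' k = ren k k' k' := by simp [ren]
  rcases key _ _ hac with rfl | ⟨rfl, rfl⟩ | ⟨rfl, rfl⟩ <;> rcases key _ _ hbd with rfl | ⟨rfl, rfl⟩ | ⟨rfl, rfl⟩
  · exact hab (by rw [h p q r t a b h1 h2 h3 hp hr hq ht])
  all_goals try (apply hab; simp [ren]; done)
  · exact nc_core2 F s s (s+1) (Or.inl rfl) (Or.inr rfl) h p q r t a b d h1 h2 h3 np nq nr nt
      (by rintro rfl; exact hab rfl) (by rintro rfl; exact hab e1.symm) hp hq hr ht hs hs'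
  · exact nc_core2 F s (s+1) s (Or.inr rfl) (Or.inl rfl) h p q r t a b d h1 h2 h3 np nq nr nt
      (by rintro rfl; exact hab rfl) (by rintro rfl; exact hab e1) hp hq hr ht hs' hs
  · exact nc_core1 F s s (s+1) (Or.inl rfl) (Or.inr rfl) h p q r t a b c h1 h2 h3 np nq nr nt
      (by rintro rfl; exact hab rfl) (by rintro rfl; exact hab e1) hp hq hr ht hs hs'
  · exact nc_core1 F s (s+1) s (Or.inr rfl) (Or.inl rfl) h p q r t a b c h1 h2 h3 np nq nr nt
      (by rintro rfl; exact hab rfl) (by rintro rfl; exact hab e1.symm) hp hq hr ht hs' hs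

lemma nc_delete (A B : List ℕ) (k k' : ℕ) (h : NC (A ++ k :: k' :: B)) : NC ((A ++ B).map (ren k k')) := by
  have e : ∀ i, (A ++ B)[i]? = (A ++ k :: k' :: B)[if i < A.length then i else i + 2]? := by
    intro i
    split_ifs with hi
    · simp [List.getElem?_append, hi]
    · have h1 : ¬ (i + 2 < A.length) := by omega
      have h2 : i + 2 - A.length = (i - A.length) + 2 := by omega
      simp [List.getElem?_append, hi, h1, h2]
  intro i j l m a b h1 h2 h3 g1 g2 g3 g4
  simp only [List.getElem?_map, Option.map_eq_some_iff, e] at g1 g2 g3 g4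
  obtain ⟨x1, g1, rfl⟩ := g1
  obtain ⟨x2, g2, f2⟩ := g2
  obtain ⟨x3, g3, rfl⟩ := g3
  obtain ⟨x4, g4, f4⟩ := g4
  refine nc_merge_aux (fun i => (A ++ k :: k' :: B)[i]?) A.length k k' (by simp) (by simp [List.getElem?_append]) h 
    _ _ _ _ _ _ _ _ ?_ ?_ ?_ ?_ ?_ ?_ ?_ g1 g3 g2 g4 f2.symm f4.symm <;> (split_ifs <;> omega)

lemma nc_nest (A B C : List ℕ) (h : NC (A ++ B)) (hC : NC C) (hd : ∀ x ∈ C, x ∉ A ++ B) : NC (A ++ C ++ B) := by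
  have e : ∀ i a, (A ++ C ++ B)[i]? = some a → 
     (A.length ≤ i ∧ i < A.length + C.length ∧ C[i - A.length]? = some a) ∨ 
     ((i < A.length ∧ (A++B)[i]? = some a) ∨ (A.length + C.length ≤ i ∧ (A++B)[i - C.length]? = some a)) := by
    intro i a hi
    rcases Nat.lt_or_ge i A.length with h1 | h1
    · right; left
      simp [List.getElem?_append, h1] at hi ⊢
      simpa [show i < A.length + C.length by omega] using hi
    · rcases Nat.lt_or_ge i (A.length + C.length) with h2 | h2
      · left
        refine ⟨h1, h2, ?_⟩
        simpa [List.getElem?_append, h2, show ¬ i < A.length by omega, show i - A.length < C.length by omega] using hi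
      · right; right
        refine ⟨h2, ?_⟩
        rw [List.getElem?_append_right (by simpa using h2)] at hi
        rw [List.getElem?_append_right (by omega)]
        rw [← hi]; congr 1; simp; omega
  have memC : ∀ i a, C[i]? = some a → a ∈ C := fun i a => List.mem_of_getElem?
  have memD : ∀ i a, (A++B)[i]? = some a → a ∉ C := fun i a h1 h2 => hd a h2 (List.mem_of_getElem? h1)
  intro i j k m a b h1 h2 h3 g1 g2 g3 g4
  have E1 := e _ _ g1
  have E2 := e _ _ g2
  have E3 := e _ _ g3
  have E4 := e _ _ g4
  by_cases ha : a ∈ C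
  · have F1 : A.length ≤ i ∧ i < A.length + C.length ∧ C[i - A.length]? = some a := by
      rcases E1 with h | h | h
      · exact h
      · exact absurd ha (memD _ _ h.2)
      · exact absurd ha (memD _ _ h.2)
    have F2 : A.length ≤ k ∧ k < A.length + C.length ∧ C[k - A.length]? = some a := by
      rcases E2 with h | h | h
      · exact h
      · exact absurd ha (memD _ _ h.2)
      · exact absurd ha (memD _ _ h.2)
    have F3 : A.length ≤ j ∧ j < A.length + C.length ∧ C[j - A.length]? = some b := by
      rcases E3 with h | h | h
      · exact h
      · omega
      · omega
    have hb := memC _ _ F3.2.2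
    have F4 : A.length ≤ m ∧ m < A.length + C.length ∧ C[m - A.length]? = some b := by
      rcases E4 with h | h | h
      · exact h
      · exact absurd hb (memD _ _ h.2)
      · exact absurd hb (memD _ _ h.2)
    exact hC _ _ _ _ a b (by omega) (by omega) (by omega) F1.2.2 F2.2.2 F3.2.2 F4.2.2
  · have F1 := E1.resolve_left (fun h => ha (memC _ _ h.2.2))
    have F2 := E2.resolve_left (fun h => ha (memC _ _ h.2.2))
    have hb : b ∉ C := by
      intro hb
      have F3 : A.length ≤ j ∧ j < A.length + C.length ∧ C[j - A.length]? = some b := by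
        rcases E3 with h | h | h
        · exact h
        · exact absurd hb (memD _ _ h.2)
        · exact absurd hb (memD _ _ h.2)
      have F4 : A.length ≤ m ∧ m < A.length + C.length ∧ C[m - A.length]? = some b := by
        rcases E4 with h | h | h
        · exact h
        · exact absurd hb (memD _ _ h.2)
        · exact absurd hb (memD _ _ h.2)
      omega
    have F3 := E3.resolve_left (fun h => hb (memC _ _ h.2.2))
    have F4 := E4.resolve_left (fun h => hb (memC _ _ h.2.2))
    rcases F1 with F1 | F1 <;> rcases F2 with F2 | F2 <;> rcases F3 with F3 | F3 <;> rcases F4 with F4 | F4 <;> 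
      first
      | omega
      | exact h _ _ _ _ a b (by omega) (by omega) (by omega) F1.2 F2.2 F3.2 F4.2


abbrev Ltr (ι : Type) := (ι × ℕ) × Bool

def linv {ι : Type} (z : Ltr ι) : Ltr ι := (z.1, !z.2)

lemma linv_linv {ι : Type} (z : Ltr ι) : linv (linv z) = z := by simp [linv]

def cls {ι : Type} (k : ℕ) (l : List (Ltr ι × ℕ)) : Multiset (Ltr ι) :=
  Multiset.map Prod.fst (Multiset.filter (fun p => p.2 = k) (l : Multiset (Ltr ι × ℕ)))

lemma cls_nil {ι : Type} (k : ℕ) : cls k ([] : List (Ltr ι × ℕ)) = 0 := by simp [cls]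

lemma cls_append {ι : Type} (k : ℕ) (A B : List (Ltr ι × ℕ)) :
    cls k (A ++ B) = cls k A + cls k B := by
  simp only [cls, ← Multiset.coe_add, Multiset.filter_add, Multiset.map_add]

lemma cls_cons {ι : Type} (k : ℕ) (p : Ltr ι × ℕ) (B : List (Ltr ι × ℕ)) :
    cls k (p :: B) = (if p.2 = k then {p.1} else 0) + cls k B := by
  simp only [cls, ← Multiset.cons_coe, Multiset.filter_cons, Multiset.map_add]
  split_ifs <;> simp

lemma mem_cls {ι : Type} (k : ℕ) (l : List (Ltr ι × ℕ)) (z : Ltr ι) : z ∈ cls k l ↔ (z, k) ∈ l := by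
  simp [cls]

lemma cls_eq_zero {ι : Type} (k : ℕ) (l : List (Ltr ι × ℕ)) (h : ∀ p ∈ l, p.2 ≠ k) : cls k l = 0 := by
  rw [Multiset.eq_zero_iff_forall_notMem]
  intro z hz
  exact h _ ((mem_cls _ _ _).1 hz) rfl

structure Good {ι : Type} (r : ℕ) (l : List (Ltr ι × ℕ)) : Prop where
  nc : NC (l.map Prod.snd)
  pur : ∀ k z z', (z, k) ∈ l → (z', k) ∈ l → z.1.1 = z'.1.1
  pair : ∀ k, r ≤ k → cls k l = 0 ∨ ∃ z, cls k l = {z, linv z}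

def SS {ι : Type} (r : ℕ) (w : List (Ltr ι)) : Prop := ∃ l, l.map Prod.fst = w ∧ Good r l

lemma cls_recolor {ι : Type} (g : ℕ → ℕ) (l : List (Ltr ι × ℕ)) (k : ℕ) :
    (∀ c, g c = k ↔ False) → cls k (l.map (fun p => (p.1, g p.2))) = 0 := by
  intro h
  apply cls_eq_zero
  intro p hp
  simp only [List.mem_map] at hp
  obtain ⟨q, _, rfl⟩ := hp
  exact fun h' => (h _).1 h'

lemma cls_recolor_inj {ι : Type} (g : ℕ → ℕ) (l : List (Ltr ι × ℕ)) (k c : ℕ) 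
    (h : ∀ c', g c' = k ↔ c' = c) : cls k (l.map (fun p => (p.1, g p.2))) = cls c l := by
  induction l with
  | nil => simp [cls_nil]
  | cons p l ih => simp only [List.map_cons, cls_cons, ih, h]

lemma cls_recolor_two {ι : Type} (g : ℕ → ℕ) (l : List (Ltr ι × ℕ)) (k c d : ℕ) (hcd : c ≠ d)
    (h : ∀ c', g c' = k ↔ c' = c ∨ c' = d) :
    cls k (l.map (fun p => (p.1, g p.2))) = cls c l + cls d l := by
  induction l with
  | nil => simp [cls_nil]
  | cons p l ih =>
    simp only [List.map_cons, cls_cons, ih, h]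
    by_cases h1 : p.2 = c
    · have : p.2 ≠ d := by omega
      simp [h1, hcd, add_assoc]
    · by_cases h2 : p.2 = d
      · simp [h2, hcd.symm, ← add_assoc, add_comm]
      · simp [h1, h2]

lemma Good.recolor {ι : Type} {r r' : ℕ} {l : List (Ltr ι × ℕ)} (h : Good r l) (g : ℕ → ℕ)
    (hg : Function.Injective g) (hr : ∀ c, r' ≤ g c → r ≤ c) :
    Good r' (l.map (fun p => (p.1, g p.2))) := by
  refine ⟨?_, ?_, ?_⟩
  · intro i j k m a b h1 h2 h3 g1 g2 g3 g4
    simp only [List.map_map, List.getElem?_map, Option.map_eq_some_iff, Function.comp] at g1 g2 g3 g4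
    obtain ⟨x1, g1, rfl⟩ := g1
    obtain ⟨x2, g2, f2⟩ := g2
    obtain ⟨x3, g3, rfl⟩ := g3
    obtain ⟨x4, g4, f4⟩ := g4
    congr 1
    exact h.nc i j k m _ _ h1 h2 h3 (by simp [g1]) (by simp [g2, hg f2]) (by simp [g3]) (by simp [g4, hg f4])
  · intro k z z' h1 h2
    simp only [List.mem_map, Prod.mk.injEq] at h1 h2
    obtain ⟨p, hp, rfl, rfl⟩ := h1
    obtain ⟨q, hq, rfl, h2⟩ := h2
    exact h.pur p.2 _ _ hp (by rw [← hg h2]; exact hq)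
  · intro k hk
    by_cases hc : ∃ c, g c = k
    · obtain ⟨c, rfl⟩ := hc
      rw [cls_recolor_inj g l (g c) c (fun c' => hg.eq_iff)]
      exact h.pair c (hr c hk)
    · left
      exact cls_recolor g l k (fun c => iff_false_intro (fun h => hc ⟨c, h⟩))

lemma Good.nest {ι : Type} {r : ℕ} {A B C : List (Ltr ι × ℕ)} (h : Good r (A ++ B)) (hC : Good r C)
    (hd : ∀ p ∈ C, ∀ q ∈ A ++ B, p.2 ≠ q.2) : Good r (A ++ C ++ B) := by
  refine ⟨?_, ?_, ?_⟩
  · simp only [List.map_append]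
    apply nc_nest
    · simpa using h.nc
    · exact hC.nc
    · intro x hx hx'
      rw [← List.map_append] at hx'
      obtain ⟨p, hp, rfl⟩ := List.mem_map.1 hx
      obtain ⟨q, hq, h⟩ := List.mem_map.1 hx'
      exact hd p hp q hq h.symm
  · have e : ∀ p, p ∈ A ++ C ++ B → p ∈ A ++ B ∨ p ∈ C := by
      intro p; simp only [List.mem_append]; tauto
    intro k z z' h1 h2
    rcases e _ h1 with h1 | h1 <;> rcases e _ h2 with h2 | h2
    · exact h.pur k _ _ h1 h2
    · exact absurd rfl (hd (z', k) h2 (z, k) h1)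
    · exact absurd rfl (hd (z, k) h1 (z', k) h2)
    · exact hC.pur k _ _ h1 h2
  · intro k hk
    have e : cls k (A ++ C ++ B) = cls k (A ++ B) + cls k C := by
      simp only [cls_append]; abel
    rw [e]
    by_cases h0 : cls k C = 0
    · rw [h0, add_zero]; exact h.pair k hk
    · have : cls k (A ++ B) = 0 := by
        obtain ⟨z, hz⟩ := Multiset.exists_mem_of_ne_zero h0
        apply cls_eq_zero
        intro p hp h
        exact hd _ ((mem_cls _ _ _).1 hz) _ hp h.symm
      rw [this, zero_add]; exact hC.pair k hk

lemma exists_fresh {ι : Type} (r : ℕ) (l : List (Ltr ι × ℕ)) : ∃ k, r ≤ k ∧ ∀ p ∈ l, p.2 ≠ k := by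
  refine ⟨r + (l.map Prod.snd).sum + 1, by omega, ?_⟩
  intro p hp h
  have := List.single_le_sum (l := l.map Prod.snd) (by simp) p.2 (List.mem_map_of_mem hp)
  omega

lemma good_two {ι : Type} (r k : ℕ) (z : Ltr ι) : Good r [(z, k), (linv z, k)] := by
  refine ⟨?_, ?_, ?_⟩
  · intro i j k' m a b h1 h2 h3 g1 g2 g3 g4
    have := (List.getElem?_eq_some_iff.1 g4).1
    simp at this
    omega
  · intro k' y y'
    simp
    rintro (⟨rfl, rfl⟩ | ⟨rfl, rfl⟩) (⟨rfl, _⟩ | ⟨rfl, _⟩) <;> simp [linv]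
  · intro k' _
    by_cases h : k = k'
    · right; refine ⟨z, ?_⟩
      simp [cls_cons, cls_nil, h]
    · left
      simp [cls_cons, cls_nil, h]

lemma good_nil {ι : Type} (r : ℕ) : Good r ([] : List (Ltr ι × ℕ)) := by
  refine ⟨?_, ?_, ?_⟩
  · intro i j k' m a b h1 h2 h3 g1 
    simp at g1
  · simp
  · intros; left; exact cls_nil _

lemma SS.insert {ι : Type} {r : ℕ} {A B : List (Ltr ι)} (z : Ltr ι) (h : SS r (A ++ B)) :
    SS r (A ++ z :: linv z :: B) := by
  obtain ⟨l, hl, hg⟩ := h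
  obtain ⟨A', B', rfl, rfl, rfl⟩ := List.map_eq_append_iff.1 hl
  obtain ⟨k, hk, hf⟩ := exists_fresh r (A' ++ B')
  refine ⟨A' ++ [(z,k),(linv z,k)] ++ B', by simp, ?_⟩
  refine hg.nest (good_two r k z) ?_
  intro p hp q hq h
  have : p.2 = k := by
    simp at hp; rcases hp with rfl | rfl <;> rfl
  exact hf q hq (by omega)

lemma SS.wrap {ι : Type} {r : ℕ} {w : List (Ltr ι)} (z : Ltr ι) (h : SS r w) :
    SS r (z :: (w ++ [linv z])) := by
  obtain ⟨l, rfl, hg⟩ := h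
  obtain ⟨k, hk, hf⟩ := exists_fresh r l
  refine ⟨[(z,k)] ++ l ++ [(linv z,k)], by simp, ?_⟩
  refine Good.nest (good_two r k z) hg ?_
  intro p hp q hq h
  have : q.2 = k := by
    simp at hq; rcases hq with rfl | rfl <;> rfl
  exact hf p hp (by omega)

lemma SS.append {ι : Type} {r s : ℕ} {w u : List (Ltr ι)} (h : SS r w) (h' : SS s u) :
    SS (r + s) (w ++ u) := by
  obtain ⟨l, rfl, hg⟩ := h
  obtain ⟨l', rfl, hg'⟩ := h'
  have G1 := hg.recolor (r' := r + s) (fun c => if c < r then c else r + s + 2 * c) 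
    (by intro a b; dsimp only; split_ifs <;> omega) (by intro c; split_ifs <;> omega)
  have G2 := hg'.recolor (r' := r + s) (fun c => if c < s then r + c else r + s + 2 * c + 1) 
    (by intro a b; dsimp only; split_ifs <;> omega) (by intro c; split_ifs <;> omega)
  refine ⟨_, ?_, Good.nest (A := []) (B := _) (by simpa using G2) G1 ?_⟩
  · simp [Function.comp_def]
  · intro p hp q hq
    simp only [List.mem_map, List.nil_append] at hp hq
    obtain ⟨p', _, rfl⟩ := hp
    obtain ⟨q', _, rfl⟩ := hq
    simp only
    split_ifs <;> omega

lemma pair_erase {ι : Type} {z x : Ltr ι} {m : Multiset (Ltr ι)} (h : x ::ₘ m = {z, linv z}) : m = {linv x} := by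
  have hx : x ∈ ({z, linv z} : Multiset (Ltr ι)) := by rw [← h]; simp
  have hx' : x = z ∨ x = linv z := by simpa using hx
  rcases hx' with rfl | rfl
  · exact (Multiset.cons_inj_right x).1 h
  · rw [linv_linv]
    have : ({z, linv z} : Multiset (Ltr ι)) = linv z ::ₘ {z} := Multiset.pair_comm _ _
    rw [this] at h
    exact (Multiset.cons_inj_right _).1 h

lemma SS.delete {ι : Type} {r : ℕ} {A B : List (Ltr ι)} (z : Ltr ι) (h : SS r (A ++ z :: linv z :: B)) :
    SS r (A ++ B) := by
  obtain ⟨l, hl, hg⟩ := h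
  obtain ⟨A', B₀, rfl, rfl, hB⟩ := List.map_eq_append_iff.1 hl
  obtain ⟨⟨z1, k⟩, B₁, rfl, rfl, hB⟩ := List.map_eq_cons_iff.1 hB
  obtain ⟨⟨z2, k'⟩, B', rfl, h2, rfl⟩ := List.map_eq_cons_iff.1 hB
  simp only at h2
  subst h2
  refine ⟨(A' ++ B').map (fun p => (p.1, ren k k' p.2)), by simp [Function.comp_def], ?_, ?_, ?_⟩
  · have := nc_delete (A'.map Prod.snd) (B'.map Prod.snd) k k' (by simpa using hg.nc)
    simpa [Function.comp_def] using this
  · intro c y y' h1 h2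
    simp only [List.mem_map, Prod.mk.injEq] at h1 h2
    obtain ⟨⟨p, a⟩, hp, rfl, rfl⟩ := h1
    obtain ⟨⟨q, b⟩, hq, rfl, h2⟩ := h2
    simp only at h2 ⊢
    have m1 : (p, a) ∈ A' ++ (z1, k) :: (linv z1, k') :: B' := by
      simp only [List.mem_append, List.mem_cons] at hp ⊢; tauto
    have m2 : (q, b) ∈ A' ++ (z1, k) :: (linv z1, k') :: B' := by
      simp only [List.mem_append, List.mem_cons] at hq ⊢; tauto
    have m3 : (z1, k) ∈ A' ++ (z1, k) :: (linv z1, k') :: B' := by simp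
    have m4 : (linv z1, k') ∈ A' ++ (z1, k) :: (linv z1, k') :: B' := by simp
    have hk : ∀ p, (p, k) ∈ A' ++ (z1, k) :: (linv z1, k') :: B' → p.1.1 = z1.1.1 := 
      fun p hp => hg.pur k _ _ hp m3
    have hk' : ∀ p, (p, k') ∈ A' ++ (z1, k) :: (linv z1, k') :: B' → p.1.1 = z1.1.1 := 
      fun p hp => hg.pur k' _ (linv z1) hp m4
    have : a = b ∨ ((a = k ∨ a = k') ∧ (b = k ∨ b = k')) := by
      revert h2; unfold ren; split_ifs <;> omega
    rcases this with rfl | ⟨h3, h4⟩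
    · exact hg.pur a _ _ m1 m2
    · trans z1.1.1
      · rcases h3 with rfl | rfl
        · exact hk _ m1
        · exact hk' _ m1
      · symm
        rcases h4 with rfl | rfl
        · exact hk _ m2
        · exact hk' _ m2
  · intro c hc
    have e : ∀ c, cls c (A' ++ (z1, k) :: (linv z1, k') :: B') = 
       (if k = c then {z1} else 0) + ((if k' = c then {linv z1} else 0) + cls c (A' ++ B')) := by
      intro c; simp only [cls_append, cls_cons]; abel
    by_cases hkk : k = k'
    · subst hkk
      rw [cls_recolor_inj (ren k k) _ c c (by intro c'; unfold ren; split_ifs <;> omega)]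
      have := hg.pair c hc
      rw [e] at this
      by_cases hkc : k = c
      · simp only [hkc, if_true] at this
        rcases this with h | ⟨z, h⟩
        · simp at h
        · have := pair_erase (x := z1) (m := {linv z1} + cls c (A' ++ B')) h
          left
          have h3 : linv z1 ::ₘ cls c (A' ++ B') = linv z1 ::ₘ 0 := this
          exact (Multiset.cons_inj_right _).1 h3
      · simpa [hkc] using this
    · by_cases hcm : c = min k k'
      · rw [cls_recolor_two (ren k k') _ c k k' hkk (by intro c'; unfold ren; split_ifs <;> omega)]
        right
        have h1 := hg.pair k (by omega)
        have h2 := hg.pair k' (by omega)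
        rw [e] at h1 h2
        simp only [hkk, Ne.symm hkk, if_true, if_false, zero_add] at h1 h2
        have h3 : cls k (A' ++ B') = {linv z1} := by
          rcases h1 with h | ⟨z, h⟩
          · simp at h
          · exact pair_erase h
        have h4 : cls k' (A' ++ B') = {linv (linv z1)} := by
          rcases h2 with h | ⟨z, h⟩
          · simp at h
          · exact pair_erase h
        exact ⟨linv z1, by rw [h3, h4]; rfl⟩
      · by_cases hcm' : c = max k k'
        · left
          apply cls_recolor
          intro c'; unfold ren; split_ifs <;> simp <;> omega
        · rw [cls_recolor_inj (ren k k') _ c c (by intro c'; unfold ren; split_ifs <;> omega)]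
          have := hg.pair c hc
          rw [e] at this
          simpa [show k ≠ c by omega, show k' ≠ c by omega] using this

lemma SS.congr {ι : Type} {r : ℕ} {w u : List (Ltr ι)} (e : FreeGroup.mk w = FreeGroup.mk u) (h : SS r w) : SS r u := by
  obtain ⟨c, h1, h2⟩ := FreeGroup.Red.exact.1 e
  clear e
  have hc : SS r c := by
    clear h2
    induction h1 with
    | refl => exact h
    | tail _ hs ih =>
      cases hs with
      | not => exact SS.delete (_, _) ih
  clear h1 h
  induction h2 using Relation.ReflTransGen.head_induction_on with
  | refl => exact hc
  | head hs _ ih =>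
    cases hs with
    | not => exact SS.insert (_, _) ih

lemma SS.conj {ι : Type} {r : ℕ} {w : List (Ltr ι)} (g : List (Ltr ι)) (h : SS r w) : 
    SS r (g ++ w ++ FreeGroup.invRev g) := by
  induction g with
  | nil => simpa using h
  | cons z g ih => 
    have := ih.wrap z
    simpa [FreeGroup.invRev, linv] using this

lemma SS.of_pure {ι : Type} (α : ι) (w : List (Ltr ι)) (h : ∀ z ∈ w, z.1.1 = α) : SS 1 w := by
  refine ⟨w.map (fun z => (z, 0)), by simp [Function.comp_def], ?_, ?_, ?_⟩
  · intro i j k m a b h1 h2 h3 g1 g2 g3 g4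
    simp only [List.map_map, List.getElem?_map, Option.map_eq_some_iff, Function.comp] at g1 g3
    obtain ⟨_, _, rfl⟩ := g1
    obtain ⟨_, _, rfl⟩ := g3
    rfl
  · intro k z z' h1 h2
    simp only [List.mem_map, Prod.mk.injEq] at h1 h2
    obtain ⟨_, h1, rfl, _⟩ := h1
    obtain ⟨_, h2, rfl, _⟩ := h2
    rw [h _ h1, h _ h2]
  · intro k hk
    left
    apply cls_eq_zero
    intro p hp
    simp only [List.mem_map] at hp
    obtain ⟨_, h1, rfl⟩ := hp
    simp; omega

lemma Good.mk_eq_one {ι : Type} (n : ℕ) : ∀ (l : List (Ltr ι × ℕ)), l.length ≤ n → Good 0 l → 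
    FreeGroup.mk (l.map Prod.fst) = 1 := by
  induction n with
  | zero => 
    intro l hl _
    have : l = [] := List.length_eq_zero_iff.1 (by omega)
    subst this; rfl
  | succ n ih =>
    intro l hl hg
    rcases l with _ | ⟨⟨x, k⟩, t⟩
    · rfl
    have hp := hg.pair k (by omega)
    rw [cls_cons] at hp
    have h1 : cls k t = {linv x} := by
      simp only [if_true] at hp
      rcases hp with h | ⟨z, h⟩
      · simp at h
      · exact pair_erase h
    have hm : (linv x, k) ∈ t := (mem_cls _ _ _).1 (by rw [h1]; simp)
    obtain ⟨u, v, rfl⟩ := List.append_of_mem hm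
    have h2 : cls k (u ++ v) = 0 := by
      have : linv x ::ₘ cls k (u ++ v) = {linv x} := by
        rw [← h1]; simp only [cls_append, cls_cons, if_true, ← Multiset.singleton_add]; abel
      have h3 : linv x ::ₘ cls k (u ++ v) = linv x ::ₘ 0 := this
      exact (Multiset.cons_inj_right _).1 h3
    have hdis : ∀ p ∈ u, ∀ q ∈ v, p.2 ≠ q.2 := by
      intro p hp q hq hpq
      obtain ⟨i, hi, hpi⟩ := List.getElem_of_mem hp
      obtain ⟨j, hj, hqj⟩ := List.getElem_of_mem hq
      have := hg.nc 0 (i+1) (u.length + 1) (u.length + 2 + j) k p.2 (by omega) (by omega) (by omega)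
        (by simp) (by simp [List.getElem?_append]) (by simp [List.getElem?_append, hi, hpi])
        (by simp [List.getElem?_append, show u.length + 2 + j = (u.length + (j+1)) + 1 by omega, hj, hqj, hpq])
      have : p.1 ∈ cls k (u ++ v) := (mem_cls _ _ _).2 (by rw [this]; simp [hp])
      rw [h2] at this
      simp at this
    have hk0 : cls k u = 0 ∧ cls k v = 0 := by
      rw [cls_append] at h2
      simpa using h2
    have hu : Good 0 u := by
      refine ⟨?_, ?_, ?_⟩
      · intro i j k' m a b h1 h2 h3 g1 g2 g3 g4
        have e : ∀ i a, (u.map Prod.snd)[i]? = some a → 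
          (((x, k) :: (u ++ (linv x, k) :: v)).map Prod.snd)[i+1]? = some a := by
          intro i a h
          have := (List.getElem?_eq_some_iff.1 h).1
          simp only [List.map_cons, List.map_append, List.getElem?_cons_succ]
          rw [List.getElem?_append_left this, h]
        exact hg.nc (i+1) (j+1) (k'+1) (m+1) a b (by omega) (by omega) (by omega) (e _ _ g1) (e _ _ g2) (e _ _ g3) (e _ _ g4)
      · intro k' z z' h1 h2
        exact hg.pur k' z z' (by simp [h1]) (by simp [h2])
      · intro c _
        by_cases h0 : cls c u = 0
        · exact Or.inl h0
        · have hck : k ≠ c := by rintro rfl; exact h0 hk0.1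
          obtain ⟨z, hz⟩ := Multiset.exists_mem_of_ne_zero h0
          have : cls c v = 0 := cls_eq_zero _ _ (fun q hq h => hdis _ ((mem_cls _ _ _).1 hz) q hq h.symm)
          have hh := hg.pair c (by omega)
          simpa [cls_cons, cls_append, this, hck] using hh
    have hv : Good 0 v := by
      refine ⟨?_, ?_, ?_⟩
      · intro i j k' m a b h1 h2 h3 g1 g2 g3 g4
        have e : ∀ i a, (v.map Prod.snd)[i]? = some a → 
          (((x, k) :: (u ++ (linv x, k) :: v)).map Prod.snd)[u.length + 2 + i]? = some a := by
          intro i a h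
          rw [show u.length + 2 + i = (u.length + (i + 1)) + 1 by omega]
          simp only [List.map_cons, List.map_append, List.getElem?_cons_succ]
          rw [List.getElem?_append_right (by simp)]
          simp at h ⊢
          exact h
        exact hg.nc _ _ _ _ a b (by omega) (by omega) (by omega) (e _ _ g1) (e _ _ g2) (e _ _ g3) (e _ _ g4)
      · intro k' z z' h1 h2
        exact hg.pur k' z z' (by simp [h1]) (by simp [h2])
      · intro c _
        by_cases h0 : cls c v = 0
        · exact Or.inl h0
        · have hck : k ≠ c := by rintro rfl; exact h0 hk0.2
          obtain ⟨z, hz⟩ := Multiset.exists_mem_of_ne_zero h0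
          have : cls c u = 0 := cls_eq_zero _ _ (fun q hq h => hdis q hq _ ((mem_cls _ _ _).1 hz) h)
          have hh := hg.pair c (by omega)
          simpa [cls_cons, cls_append, this, hck] using hh
    have hl' : u.length + v.length + 2 ≤ n + 1 := by simp at hl; omega
    have I1 := ih u (by omega) hu
    have I2 := ih v (by omega) hv
    have e : FreeGroup.mk (((x, k) :: (u ++ (linv x, k) :: v)).map Prod.fst) = 
      FreeGroup.mk [x] * FreeGroup.mk (u.map Prod.fst) * (FreeGroup.mk [x])⁻¹ * FreeGroup.mk (v.map Prod.fst) := by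
      simp [FreeGroup.mul_mk, FreeGroup.inv_mk, FreeGroup.invRev, linv]
    rw [e, I1, I2, mul_one, mul_one, mul_inv_cancel]


open GriffithsWords

def ltr {ι : Type} (V : Word ι) (q : ℚ) : Ltr ι := (((V.letter q).1, (V.letter q).2.1), (V.letter q).2.2)

lemma trunc_eq {ι : Type} (V : Word ι) (N : ℕ) : V.trunc N = FreeGroup.mk ((V.truncList N).map (ltr V)) := rfl

lemma mem_truncList {ι : Type} (V : Word ι) (N : ℕ) (q : ℚ) :
    q ∈ V.truncList N ↔ q ∈ V.dom ∧ (V.letter q).2.1 ≤ N := by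
  simp [Word.truncList]

lemma truncList_sorted {ι : Type} (V : Word ι) (N : ℕ) : (V.truncList N).SortedLT := 
  Finset.sortedLT_sort _

structure Lev {ι : Type} (f : ℚ → Ltr ι) (r : ℕ) (T : List ℚ) (c : ℚ → ℕ) : Prop where
  nc : ∀ p ∈ T, ∀ q ∈ T, ∀ s ∈ T, ∀ t ∈ T, p < q → q < s → s < t → c p = c s → c q = c t → c p = c q
  pur : ∀ p ∈ T, ∀ q ∈ T, c p = c q → (f p).1.1 = (f q).1.1
  pair : ∀ p ∈ T, r ≤ c p → ∃ q ∈ T, q ≠ p ∧ c q = c p ∧ f q = linv (f p) ∧ 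
    ∀ s ∈ T, c s = c p → s = p ∨ s = q

lemma exists_label {ι : Type} (f : ℚ → Ltr ι) (T : List ℚ) (hT : T.Nodup) (l : List (Ltr ι × ℕ)) 
    (h : l.map Prod.fst = T.map f) : ∃ c : ℚ → ℕ, l = T.map (fun q => (f q, c q)) := by
  induction T generalizing l with
  | nil => exact ⟨fun _ => 0, by simpa using h⟩
  | cons q T ih =>
    obtain ⟨⟨z, k⟩, l', rfl, hz, hl⟩ := List.map_eq_cons_iff.1 h
    obtain ⟨hq, hT⟩ := List.nodup_cons.1 hT
    obtain ⟨c, rfl⟩ := ih hT l' hl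
    refine ⟨Function.update c q k, ?_⟩
    simp only at hz
    simp only [List.map_cons, Function.update_self, hz, List.cons.injEq, true_and]
    apply List.map_congr_left
    intro a ha
    rw [Function.update_of_ne]
    rintro rfl; exact hq ha

lemma cls_map {ι : Type} (f : ℚ → Ltr ι) (T : List ℚ) (c : ℚ → ℕ) (k : ℕ) :
    cls k (T.map (fun q => (f q, c q))) = (((T.filter (fun q => c q = k)).map f : List (Ltr ι)) : Multiset (Ltr ι)) := by
  induction T with
  | nil => rfl
  | cons a T ih => 
    simp only [List.map_cons, cls_cons, ih, List.filter_cons]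
    by_cases h : c a = k <;> simp [h]

lemma lev_of_good {ι : Type} (f : ℚ → Ltr ι) (r : ℕ) (T : List ℚ) (hT : T.SortedLT) (c : ℚ → ℕ)
    (h : Good r (T.map (fun q => (f q, c q)))) : Lev f r T c := by
  refine ⟨?_, ?_, ?_⟩
  · intro p hp q hq s hs t ht h1 h2 h3 e1 e2
    obtain ⟨i, hi, rfl⟩ := List.getElem_of_mem hp
    obtain ⟨j, hj, rfl⟩ := List.getElem_of_mem hq
    obtain ⟨k, hk, rfl⟩ := List.getElem_of_mem hs
    obtain ⟨m, hm, rfl⟩ := List.getElem_of_mem ht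
    have mono : ∀ (i j : ℕ) (hi : i < T.length) (hj : j < T.length), T[i] < T[j] → i < j := by
      intro i j hi hj hij
      exact (hT.strictMono_get.lt_iff_lt (a := ⟨i, hi⟩) (b := ⟨j, hj⟩)).1 hij
    exact h.nc i j k m _ _ (mono _ _ _ _ h1) (mono _ _ _ _ h2) (mono _ _ _ _ h3) 
      (by simp [hi]) (by simp [hk, e1]) (by simp [hj]) (by simp [hm, e2])
  · intro p hp q hq e
    exact h.pur (c p) _ _ (List.mem_map.2 ⟨p, hp, rfl⟩) (List.mem_map.2 ⟨q, hq, by rw [e]⟩)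
  · intro p hp hr
    have hpF : p ∈ T.filter (fun q => c q = c p) := by simp [hp]
    have hnd : (T.filter (fun q => c q = c p)).Nodup := hT.nodup.filter _
    have hmem : ∀ s, s ∈ T.filter (fun q => c q = c p) ↔ s ∈ T ∧ c s = c p := by simp
    have hc := h.pair _ hr
    rw [cls_map] at hc
    generalize T.filter (fun q => c q = c p) = F at *
    rcases hc with hc | ⟨z, hc⟩
    · have : F = [] := by simpa using hc
      subst this; simp at hpF
    · have hlen : F.length = 2 := by
        have := congrArg Multiset.card hc
        simpa using this
      obtain ⟨a, b, rfl⟩ := List.length_eq_two.1 hlen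
      have hab : a ≠ b := by simpa using hnd
      have e1 : f a ::ₘ {f b} = {z, linv z} := hc
      have e2 : f b ::ₘ {f a} = {z, linv z} := by
        rw [← hc]; exact Multiset.pair_comm _ _
      have e1 : f b = linv (f a) := by simpa using pair_erase e1
      have e2 : f a = linv (f b) := by simpa using pair_erase e2
      have ha := (hmem a).1 (by simp)
      have hb := (hmem b).1 (by simp)
      have hs : ∀ s ∈ T, c s = c p → s = a ∨ s = b := by
        intro s h1 h2
        simpa using (hmem s).2 ⟨h1, h2⟩
      rcases (show p = a ∨ p = b by simpa using hpF) with rfl | rfl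
      · exact ⟨b, hb.1, hab.symm, hb.2, e1, hs⟩
      · exact ⟨a, ha.1, hab, ha.2, e2, fun s h1 h2 => (hs s h1 h2).symm⟩

lemma good_of_lev {ι : Type} (f : ℚ → Ltr ι) (r : ℕ) (T : List ℚ) (hT : T.SortedLT) (c : ℚ → ℕ)
    (h : Lev f r T c) : Good r (T.map (fun q => (f q, c q))) := by
  refine ⟨?_, ?_, ?_⟩
  · intro i j k m a b h1 h2 h3 g1 g2 g3 g4
    simp only [List.map_map, List.getElem?_map, Option.map_eq_some_iff, Function.comp] at g1 g2 g3 g4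
    obtain ⟨x1, g1, rfl⟩ := g1
    obtain ⟨x2, g2, f2⟩ := g2
    obtain ⟨x3, g3, rfl⟩ := g3
    obtain ⟨x4, g4, f4⟩ := g4
    have mono : ∀ (i j : ℕ) (x y : ℚ), T[i]? = some x → T[j]? = some y → i < j → x < y := by
      intro i j x y hi hj hij
      obtain ⟨hi', rfl⟩ := List.getElem?_eq_some_iff.1 hi
      obtain ⟨hj', rfl⟩ := List.getElem?_eq_some_iff.1 hj
      exact (hT.strictMono_get.lt_iff_lt (a := ⟨i, hi'⟩) (b := ⟨j, hj'⟩)).2 hij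
    exact h.nc x1 (List.mem_of_getElem? g1) x3 (List.mem_of_getElem? g3) x2 (List.mem_of_getElem? g2) x4
      (List.mem_of_getElem? g4) (mono _ _ _ _ g1 g3 h1) (mono _ _ _ _ g3 g2 h2) (mono _ _ _ _ g2 g4 h3) f2.symm f4.symm
  · intro k z z' h1 h2
    simp only [List.mem_map, Prod.mk.injEq] at h1 h2
    obtain ⟨p, hp, rfl, rfl⟩ := h1
    obtain ⟨q, hq, rfl, h2⟩ := h2
    exact h.pur p hp q hq h2.symm
  · intro k hk
    rw [cls_map]
    by_cases hx : ∃ p ∈ T, c p = k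
    · obtain ⟨p, hp, rfl⟩ := hx
      obtain ⟨q, hq, hne, hc, hf, hs⟩ := h.pair p hp hk
      right
      refine ⟨f p, ?_⟩
      have : ((T.filter (fun x => c x = c p) : List ℚ) : Multiset ℚ) = {p, q} := by
        rw [Multiset.Nodup.ext]
        · intro s
          simp
          constructor
          · rintro ⟨h1, h2⟩; exact hs s h1 h2
          · rintro (rfl | rfl)
            · exact ⟨hp, rfl⟩
            · exact ⟨hq, hc⟩
        · exact hT.nodup.filter _
        · simp [hne.symm]
      rw [← Multiset.map_coe, this, ← hf]
      simp
    · left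
      push Not at hx
      have : T.filter (fun x => c x = k) = [] := by
        simpa [List.filter_eq_nil_iff] using hx
      rw [this]; rfl

open scoped Classical in
lemma lev_of_SS {ι : Type} (V : Word ι) (r N : ℕ) (h : SS r (V.trunc N).toWord) :
    ∃ c, Lev (ltr V) r (V.truncList N) c := by
  have h' : SS r ((V.truncList N).map (ltr V)) := by
    refine SS.congr ?_ h
    rw [FreeGroup.mk_toWord, trunc_eq]
  obtain ⟨l, hl, hg⟩ := h'
  obtain ⟨c, rfl⟩ := exists_label _ _ (truncList_sorted V N).nodup _ hl
  exact ⟨c, lev_of_good _ _ _ (truncList_sorted V N) _ hg⟩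

open scoped Classical in
lemma SS_of_mem {ι : Type} (g : wordGroup ι) (hg : g ∈ Subgroup.normalClosure (pureClasses ι)) :
    ∃ r, ∀ N, SS r (g.1 N).toWord := by
  have base : ∀ p ∈ pureClasses ι, ∀ h : wordGroup ι, ∀ N, 
     SS 1 ((h * p * h⁻¹ : wordGroup ι).1 N).toWord ∧ SS 1 ((h * p⁻¹ * h⁻¹ : wordGroup ι).1 N).toWord := by
    rintro p ⟨W, _, ⟨α, hα⟩, hp⟩ h N
    have h1 : ∀ z ∈ (W.truncList N).map (ltr W), z.1.1 = α := by
      intro z hz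
      obtain ⟨q, hq, rfl⟩ := List.mem_map.1 hz
      exact hα q ((mem_truncList _ _ _).1 hq).1
    have e1 : p.1 N = FreeGroup.mk ((W.truncList N).map (ltr W)) := by rw [← hp]; rfl
    have e2 : h.1 N = FreeGroup.mk (h.1 N).toWord := FreeGroup.mk_toWord.symm
    constructor
    · refine SS.congr ?_ ((SS.of_pure α _ h1).conj (h.1 N).toWord)
      rw [FreeGroup.mk_toWord]
      simp only [Subgroup.coe_mul, Subgroup.coe_inv, Pi.mul_apply, Pi.inv_apply]
      rw [e1]
      conv_rhs => rw [e2]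
      simp only [FreeGroup.mul_mk, FreeGroup.inv_mk]
    · have h2 : ∀ z ∈ FreeGroup.invRev ((W.truncList N).map (ltr W)), z.1.1 = α := by
        intro z hz
        simp only [FreeGroup.invRev, List.mem_reverse, List.mem_map] at hz
        obtain ⟨y, ⟨q, hq, rfl⟩, rfl⟩ := hz
        exact hα q ((mem_truncList _ _ _).1 hq).1
      refine SS.congr ?_ ((SS.of_pure α _ h2).conj (h.1 N).toWord)
      rw [FreeGroup.mk_toWord]
      simp only [Subgroup.coe_mul, Subgroup.coe_inv, Pi.mul_apply, Pi.inv_apply]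
      rw [e1]
      conv_rhs => rw [e2]
      simp only [FreeGroup.mul_mk, FreeGroup.inv_mk]
  unfold Subgroup.normalClosure at hg
  induction hg using Subgroup.closure_induction'' with
  | mem x hx =>
    obtain ⟨p, hp, hc⟩ := Group.mem_conjugatesOfSet_iff.1 hx
    obtain ⟨h, rfl⟩ := isConj_iff.1 hc
    exact ⟨1, fun N => (base p hp h N).1⟩
  | inv_mem x hx =>
    obtain ⟨p, hp, hc⟩ := Group.mem_conjugatesOfSet_iff.1 hx
    obtain ⟨h, rfl⟩ := isConj_iff.1 hc
    refine ⟨1, fun N => ?_⟩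
    have := (base p hp h N).2
    rwa [show h * p⁻¹ * h⁻¹ = (h * p * h⁻¹)⁻¹ by group] at this
  | one => exact ⟨0, fun N => ⟨[], by simp, good_nil _⟩⟩
  | mul x y _ _ hx hy =>
    obtain ⟨r, hr⟩ := hx
    obtain ⟨s, hs⟩ := hy
    refine ⟨r + s, fun N => SS.congr ?_ ((hr N).append (hs N))⟩
    rw [FreeGroup.mk_toWord, ← FreeGroup.mul_mk, FreeGroup.mk_toWord, FreeGroup.mk_toWord]
    rfl


open Filter in
lemma ev_exists {α : Type} (U : Ultrafilter ℕ) (S : Set α) (hS : S.Finite) (P : ℕ → α → Prop)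
    (h : ∀ᶠ N in (U : Filter ℕ), ∃ x ∈ S, P N x) : ∃ x ∈ S, ∀ᶠ N in (U : Filter ℕ), P N x := by
  by_contra hc
  push Not at hc
  have : ∀ᶠ N in (U : Filter ℕ), ∀ x ∈ S, ¬ P N x := by
    rw [Filter.eventually_all_finite hS]
    intro x hx
    exact hc x hx
  obtain ⟨N, ⟨x, hx, h1⟩, h2⟩ := (h.and this).exists
  exact h2 x hx h1

def Pr {ι : Type} (V : Word ι) (c : ℕ → ℚ → ℕ) (N : ℕ) (q q' : ℚ) : Prop :=
  q' ≠ q ∧ c N q' = c N q ∧ ltr V q' = linv (ltr V q) ∧ 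
    ∀ s ∈ V.truncList N, c N s = c N q → s = q ∨ s = q'

lemma Pr.symm {ι : Type} {V : Word ι} {c : ℕ → ℚ → ℕ} {N : ℕ} {q q' : ℚ} (h : Pr V c N q q') : Pr V c N q' q := by
  obtain ⟨h1, h2, h3, h4⟩ := h
  refine ⟨h1.symm, h2.symm, by rw [h3, linv_linv], ?_⟩
  intro s hs he
  exact (h4 s hs (he.trans h2)).symm

lemma ev_mem {ι : Type} (V : Word ι) (q : ℚ) (hq : q ∈ V.dom) :
    ∀ᶠ N in (Filter.hyperfilter ℕ : Filter ℕ), q ∈ V.truncList N := by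
  have : ∀ᶠ N in (Filter.atTop : Filter ℕ), q ∈ V.truncList N := by
    filter_upwards [Filter.eventually_ge_atTop (V.letter q).2.1] with N hN
    exact (mem_truncList _ _ _).2 ⟨hq, hN⟩
  exact Nat.hyperfilter_le_atTop this

lemma idx_of_inv {ι : Type} {V : Word ι} {p q : ℚ} (h : ltr V q = linv (ltr V p)) : 
    (V.letter q).2.1 = (V.letter p).2.1 := congrArg (fun z : Ltr ι => z.1.2) h

lemma exists_partner {ι : Type} {V : Word ι} {r : ℕ} {c : ℕ → ℚ → ℕ} 
    (hc : ∀ N, Lev (ltr V) r (V.truncList N) (c N)) (q : ℚ) (hq : q ∈ V.dom)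
    (h : ∀ᶠ N in (Filter.hyperfilter ℕ : Filter ℕ), r ≤ c N q) :
    ∃ q' ∈ V.dom, ∀ᶠ N in (Filter.hyperfilter ℕ : Filter ℕ), Pr V c N q q' := by
  have : ∀ᶠ N in (Filter.hyperfilter ℕ : Filter ℕ), 
      ∃ q' ∈ {x | x ∈ V.dom ∧ (V.letter x).2.1 ≤ (V.letter q).2.1}, Pr V c N q q' := by
    filter_upwards [h, ev_mem V q hq] with N h1 h2
    obtain ⟨q', hq', a1, a2, a3, a4⟩ := (hc N).pair q h2 h1
    exact ⟨q', ⟨((mem_truncList _ _ _).1 hq').1, (idx_of_inv a3).le⟩, a1, a2, a3, a4⟩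
  obtain ⟨q', h1, h2⟩ := ev_exists _ _ (V.finite_le _) _ this
  exact ⟨q', h1.1, h2⟩

lemma special_or {r : ℕ} (c : ℕ → ℚ → ℕ) (q : ℚ) (hn : ∀ k < r, ¬ ∀ᶠ N in (Filter.hyperfilter ℕ : Filter ℕ), c N q = k) :
    ∀ᶠ N in (Filter.hyperfilter ℕ : Filter ℕ), r ≤ c N q := by
  by_contra hcon
  have h1 := Ultrafilter.eventually_not.2 hcon
  have h2 : ∀ᶠ N in (Filter.hyperfilter ℕ : Filter ℕ), ∃ k ∈ Set.Iio r, c N q = k := by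
    filter_upwards [h1] with N hN
    exact ⟨_, not_le.1 hN, rfl⟩
  obtain ⟨k, hk, h3⟩ := ev_exists _ _ (Set.finite_Iio r) _ h2
  exact hn k hk h3

lemma no_inner {ι : Type} {V : Word ι} (hV : V.Reduced) {r : ℕ} {c : ℕ → ℚ → ℕ} 
    (hc : ∀ N, Lev (ltr V) r (V.truncList N) (c N)) (lo hi : ℚ) (hlo : lo ∈ V.dom) (hhi : hi ∈ V.dom)
    (hlt : lo < hi) (hp : ∀ᶠ N in (Filter.hyperfilter ℕ : Filter ℕ), Pr V c N lo hi)
    (hx : ∀ x ∈ V.dom, lo ≤ x → x ≤ hi → ∀ᶠ N in (Filter.hyperfilter ℕ : Filter ℕ), r ≤ c N x) : False := by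
  have hI := hV {x | x ∈ V.dom ∧ lo ≤ x ∧ x ≤ hi} ⟨fun x hx => hx.1, by
    rintro a ⟨_, ha, _⟩ b ⟨_, _, hb⟩ x hx h1 h2
    exact ⟨hx, ha.trans h1, h2.trans hb⟩⟩ ?_
  · have : lo ∈ ({x | x ∈ V.dom ∧ lo ≤ x ∧ x ≤ hi} : Set ℚ) := ⟨hlo, le_refl _, hlt.le⟩
    rw [hI] at this
    exact this
  intro N
  set W := V.restrict {x | x ∈ V.dom ∧ lo ≤ x ∧ x ≤ hi} with hW
  have hmem : ∀ x, x ∈ W.truncList N ↔ x ∈ V.dom ∧ (lo ≤ x ∧ x ≤ hi) ∧ (V.letter x).2.1 ≤ N := by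
    intro x
    rw [mem_truncList]
    simp only [hW, Word.restrict, Set.mem_inter_iff, Set.mem_setOf_eq]
    tauto
  have hev : ∀ᶠ N' in (Filter.hyperfilter ℕ : Filter ℕ), ∀ x ∈ {x | x ∈ W.truncList N}, r ≤ c N' x := by
    rw [Filter.eventually_all_finite (List.finite_toSet _)]
    intro x hx'
    have := (hmem x).1 hx'
    exact hx x this.1 this.2.1.1 this.2.1.2
  have hge : ∀ᶠ N' in (Filter.hyperfilter ℕ : Filter ℕ), N ≤ N' :=
    Nat.hyperfilter_le_atTop (Filter.eventually_ge_atTop N)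
  obtain ⟨N', hr, hge, ⟨p1, p2, p3, p4⟩, mlo, mhi⟩ := 
    (hev.and (hge.and (hp.and ((ev_mem V lo hlo).and (ev_mem V hi hhi))))).exists
  have sub : ∀ x ∈ W.truncList N, x ∈ V.truncList N' := by
    intro x hx
    have := (hmem x).1 hx
    exact (mem_truncList _ _ _).2 ⟨this.1, this.2.2.trans hge⟩
  have L := hc N'
  have key : Lev (ltr V) 0 (W.truncList N) (c N') := by
    refine ⟨?_, ?_, ?_⟩
    · intro p hp q hq s hs t ht
      exact L.nc p (sub p hp) q (sub q hq) s (sub s hs) t (sub t ht)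
    · intro p hp q hq
      exact L.pur p (sub p hp) q (sub q hq)
    · intro x hxW _
      obtain ⟨y, my, a1, a2, a3, a4⟩ := L.pair x (sub x hxW) (hr x hxW)
      have hxm := (hmem x).1 hxW
      have hidx := idx_of_inv a3
      refine ⟨y, (hmem y).2 ⟨((mem_truncList _ _ _).1 my).1, ?_, by rw [hidx]; exact hxm.2.2⟩, a1, a2, a3, 
        fun s hs => a4 s (sub s hs)⟩
      have fin : c N' x = c N' lo → lo ≤ y ∧ y ≤ hi := by
        intro he
        rcases p4 y my (a2.trans he) with rfl | rfl
        · exact ⟨le_refl _, hlt.le⟩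
        · exact ⟨hlt.le, le_refl _⟩
      by_cases e : c N' x = c N' lo
      · exact fin e
      have h1 : lo < x := lt_of_le_of_ne hxm.2.1.1 (by rintro rfl; exact e rfl)
      have h2 : x < hi := lt_of_le_of_ne hxm.2.1.2 (by rintro rfl; exact e p2)
      constructor
      · by_contra h; push Not at h
        exact e (a2.symm.trans (L.nc y my lo mlo x (sub x hxW) hi mhi h h1 h2 a2 p2.symm))
      · by_contra h; push Not at h
        exact e (L.nc lo mlo x (sub x hxW) hi mhi y my h1 h2 h p2.symm a2.symm).symm
  have := Good.mk_eq_one _ _ le_rfl (good_of_lev _ _ _ (truncList_sorted W N) _ key)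
  rw [List.map_map] at this
  exact this

lemma main {ι : Type} (V : Word ι) (hV : V.Reduced)
    (D : ℕ → Set ℚ)
    (hcover : V.dom = ⋃ n, D n)
    (horder : ∀ m n : ℕ, m < n → ∀ a ∈ D m, ∀ b ∈ D n, a < b)
    (h1 : ∀ I : Set ℚ, V.IsIntervalIn I → (V.restrict I).IsPure →
      ∃ m : ℕ, I ⊆ ⋃ n ∈ Set.Iic m, D n)
    (h2 : ∀ n : ℕ, ∃ j : ℕ,
      {q | q ∈ D n ∧ (V.letter q).2.1 = j}.ncard >
        {q | q ∈ V.dom \ D n ∧ (V.letter q).2.1 = j}.ncard)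
    (r : ℕ) (c : ℕ → ℚ → ℕ) (hc : ∀ N, Lev (ltr V) r (V.truncList N) (c N)) : False := by
  have hD : ∀ n, ∀ q ∈ D n, q ∈ V.dom := by
    intro n q hq; rw [hcover]; exact Set.mem_iUnion.2 ⟨n, hq⟩
  have hD' : ∀ q ∈ V.dom, ∃ n, q ∈ D n := by
    intro q hq; rw [hcover] at hq; exact Set.mem_iUnion.1 hq
  have hne : ∀ n, ∃ q, q ∈ D n := by
    intro n
    obtain ⟨j, hj⟩ := h2 n
    have : {q | q ∈ D n ∧ (V.letter q).2.1 = j}.Nonempty := by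
      apply Set.nonempty_of_ncard_ne_zero; omega
    obtain ⟨q, hq⟩ := this
    exact ⟨q, hq.1⟩
  -- comparing positions and indices
  have hidx : ∀ m n a b, a ∈ D m → b ∈ D n → a ≤ b → m ≤ n := by
    intro m n a b ha hb hab
    by_contra h
    exact absurd (horder n m (by omega) b hb a ha) (not_lt.2 hab)
  let B : ℕ → ℚ → Prop := fun k q => ∀ᶠ N in (Filter.hyperfilter ℕ : Filter ℕ), c N q = k
  have contra : ∀ q, ∀ k < r, B k q → (∀ᶠ N in (Filter.hyperfilter ℕ : Filter ℕ), r ≤ c N q) → False := by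
    intro q k hk hB h
    obtain ⟨N, e1, e2⟩ := (hB.and h).exists
    omega
  -- no pair in a region free of special letters
  have inner : ∀ lo hi, lo ∈ V.dom → hi ∈ V.dom → 
      (∀ᶠ N in (Filter.hyperfilter ℕ : Filter ℕ), Pr V c N lo hi) →
      (∀ x ∈ V.dom, min lo hi ≤ x → x ≤ max lo hi → ∀ k < r, ¬ B k x) → False := by
    intro lo hi hlo hhi hp hx
    have hne : hi ≠ lo := by
      obtain ⟨N, hN⟩ := hp.exists
      exact hN.1
    rcases lt_or_gt_of_ne hne with h | h
    · refine no_inner hV hc hi lo hhi hlo h (hp.mono fun N h => h.symm) ?_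
      intro x hxd a b
      exact special_or c x (hx x hxd (by simp [a]) (by simp [b]))
    · refine no_inner hV hc lo hi hlo hhi h hp ?_
      intro x hxd a b
      exact special_or c x (hx x hxd (by simp [a]) (by simp [b]))
  by_cases hA : ∃ k < r, ∀ m, ∃ n ≥ m, ∃ q ∈ D n, B k q
  · obtain ⟨k, hk, hcof⟩ := hA
    have hoth : ∀ l < r, ∃ m, l ≠ k → ∀ n ≥ m, ∀ q ∈ D n, ¬ B l q := by
      intro l hl
      by_cases hlk : l = k
      · exact ⟨0, fun h => absurd hlk h⟩
      by_contra hcon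
      push Not at hcon
      obtain ⟨n1, _, b1, hb1, B1⟩ := hcof 0
      obtain ⟨_, n2, hn2, b2, hb2, B2⟩ := hcon (n1+1)
      obtain ⟨n3, hn3, b3, hb3, B3⟩ := hcof (n2+1)
      obtain ⟨_, n4, hn4, b4, hb4, B4⟩ := hcon (n3+1)
      have M1 := ev_mem V b1 (hD _ _ hb1)
      have M2 := ev_mem V b2 (hD _ _ hb2)
      have M3 := ev_mem V b3 (hD _ _ hb3)
      have M4 := ev_mem V b4 (hD _ _ hb4)
      obtain ⟨N, e1, e2, e3, e4, m1, m2, m3, m4⟩ := 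
        (B1.and (B2.and (B3.and (B4.and (M1.and (M2.and (M3.and M4))))))).exists
      have := (hc N).nc b1 m1 b2 m2 b3 m3 b4 m4 (horder n1 n2 (by omega) _ hb1 _ hb2)
        (horder n2 n3 (by omega) _ hb2 _ hb3) (horder n3 n4 (by omega) _ hb3 _ hb4) (by omega) (by omega)
      omega
    choose! mm hmm using hoth
    obtain ⟨m, hm⟩ : ∃ m, ∀ l < r, mm l ≤ m := by
      refine ⟨(Finset.range r).sup mm, fun l hl => Finset.le_sup (f := mm) (Finset.mem_range.2 hl)⟩
    obtain ⟨n0, hn0, b, hb, Bb⟩ := hcof m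
    have hbd := hD _ _ hb
    have noB : ∀ x ∈ V.dom, b ≤ x → ∀ l < r, l ≠ k → ¬ B l x := by
      intro x hx hbx l hl hlk
      obtain ⟨n, hn⟩ := hD' x hx
      have := hidx n0 n b x hb hn hbx
      have := hm l hl
      exact hmm l hl hlk n (by omega) x hn
    have tail : ∀ q ∈ V.dom, b < q → B k q := by
      intro q hq hbq
      by_contra hBq
      have hge : ∀ᶠ N in (Filter.hyperfilter ℕ : Filter ℕ), r ≤ c N q := by
        apply special_or
        intro l hl
        by_cases hlk : l = k
        · rw [hlk]; exact hBq
        · exact noB q hq hbq.le l hl hlk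
      obtain ⟨q', hq', hp⟩ := exists_partner hc q hq hge
      obtain ⟨nq, hnq⟩ := hD' q hq
      obtain ⟨n1, hn1, b', hb', Bb'⟩ := hcof (nq + 1)
      have hqb' : q < b' := horder nq n1 (by omega) _ hnq _ hb'
      have Mb := ev_mem V b hbd
      have Mb' := ev_mem V b' (hD _ _ hb')
      have Mq := ev_mem V q hq
      have Mq' := ev_mem V q' hq'
      have hbq' : b < q' := by
        obtain ⟨N, e1, e2, e3, e4, m1, m2, m3, m4⟩ := 
          (Bb.and (Bb'.and (hp.and (hge.and (Mb.and (Mb'.and (Mq.and Mq'))))))).exists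
        by_contra h
        have h' : q' < b := lt_of_le_of_ne (not_lt.1 h) (by rintro rfl; have := e3.2.1; omega)
        have := (hc N).nc q' m4 b m1 q m3 b' m2 h' hbq hqb' e3.2.1 (by omega)
        have := e3.2.1
        omega
      refine inner q q' hq hq' hp ?_
      intro x hx hx1 hx2 l hl hBx
      have hbx : b < x := lt_of_lt_of_le (lt_min hbq hbq') hx1
      by_cases hlk : l = k
      · subst hlk
        have Mx := ev_mem V x hx
        obtain ⟨N, e1, e2, e3, e4, m1, m2, m3, m4⟩ := 
          (Bb.and (hBx.and (hp.and (hge.and (Mb.and (Mx.and (Mq.and Mq'))))))).exists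
        have e5 := e3.2.1
        have n1 : x ≠ q := by rintro rfl; omega
        have n2 : x ≠ q' := by rintro rfl; omega
        rcases lt_or_gt_of_ne e3.1 with h | h
        · rw [min_eq_right h.le] at hx1
          rw [max_eq_left h.le] at hx2
          have := (hc N).nc b m1 q' m4 x m2 q m3 hbq' (lt_of_le_of_ne hx1 n2.symm) (lt_of_le_of_ne hx2 n1)
            (by omega) (by omega)
          omega
        · rw [min_eq_left h.le] at hx1
          rw [max_eq_right h.le] at hx2
          have := (hc N).nc b m1 q m3 x m2 q' m4 hbq (lt_of_le_of_ne hx1 n1.symm) (lt_of_le_of_ne hx2 n2)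
            (by omega) (by omega)
          omega
      · exact noB x hx hbx.le l hl hlk hBx
    obtain ⟨M, hM⟩ := h1 {q | q ∈ V.dom ∧ b < q} ⟨fun q hq => hq.1, by
        rintro a ⟨_, ha⟩ d _ x hx h1 _
        exact ⟨hx, lt_of_lt_of_le ha h1⟩⟩ ⟨(V.letter b).1, by
        rintro q ⟨_, hq, hbq⟩
        obtain ⟨N, e1, e2, m1, m2⟩ := 
          (Bb.and ((tail q hq hbq).and ((ev_mem V b hbd).and (ev_mem V q hq)))).exists
        exact (hc N).pur q m2 b m1 (e2.trans e1.symm)⟩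
    obtain ⟨x, hx⟩ := hne (max M n0 + 1)
    have hbx : b < x := horder n0 _ (by omega) b hb x hx
    have := hM ⟨hD _ _ hx, hbx⟩
    simp only [Set.mem_iUnion, Set.mem_Iic] at this
    obtain ⟨n, hn, hxn⟩ := this
    have := hidx _ _ x x hx hxn le_rfl
    omega
  · push Not at hA
    choose! mm hmm using hA
    obtain ⟨m, hm⟩ : ∃ m, ∀ l < r, mm l ≤ m := by
      refine ⟨(Finset.range r).sup mm, fun l hl => Finset.le_sup (f := mm) (Finset.mem_range.2 hl)⟩
    have noB : ∀ n ≥ m, ∀ x ∈ D n, ∀ l < r, ¬ B l x := by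
      intro n hn x hx l hl
      have := hm l hl
      exact hmm l hl n (by omega) x hx
    obtain ⟨j, hj⟩ := h2 m
    have part : ∀ q ∈ D m, ∃ q' ∈ V.dom, ∀ᶠ N in (Filter.hyperfilter ℕ : Filter ℕ), Pr V c N q q' := by
      intro q hq
      exact exists_partner hc q (hD _ _ hq) (special_or c q (noB m le_rfl q hq))
    choose! φ hφ1 hφ2 using part
    have hφ3 : ∀ q ∈ D m, φ q ∉ D m := by
      intro q hq hq'
      refine inner q (φ q) (hD _ _ hq) (hφ1 q hq) (hφ2 q hq) ?_
      intro x hx hx1 _ l hl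
      obtain ⟨n, hn⟩ := hD' x hx
      refine noB n ?_ x hn l hl
      rcases min_choice q (φ q) with h | h
      · exact hidx _ _ _ _ hq hn (by rw [← h]; exact hx1)
      · exact hidx _ _ _ _ hq' hn (by rw [← h]; exact hx1)
    have : {q | q ∈ D m ∧ (V.letter q).2.1 = j}.ncard ≤ {q | q ∈ V.dom \ D m ∧ (V.letter q).2.1 = j}.ncard := by
      have hfin : {q | q ∈ V.dom \ D m ∧ (V.letter q).2.1 = j}.Finite :=
        (V.finite_le j).subset (fun q hq => ⟨hq.1.1, hq.2.le⟩)
      refine Set.ncard_le_ncard_of_injOn φ ?_ ?_ hfin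
      · rintro q ⟨hq, hqj⟩
        refine ⟨⟨hφ1 q hq, hφ3 q hq⟩, ?_⟩
        obtain ⟨N, hN⟩ := (hφ2 q hq).exists
        rw [idx_of_inv hN.2.2.1, hqj]
      · rintro q ⟨hq, _⟩ q2 ⟨hq2, _⟩ he
        obtain ⟨N, e1, e2, m2⟩ := ((hφ2 q hq).and ((hφ2 q2 hq2).and (ev_mem V q2 (hD _ _ hq2)))).exists
        rcases e1.2.2.2 q2 m2 (by rw [← e2.2.1, ← he, e1.2.1]) with h | h
        · exact h.symm
        · exact absurd (h ▸ hq2) (hφ3 q hq)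
    omega

end ConeProof

open GriffithsWords GriffithsWords.Word in
/-- **Lemma.** Let `V ∈ Red_κ` be a reduced word which decomposes as an `ω`-indexed
concatenation `V ≡ ∏_{n∈ω} V_n` (encoded by a decomposition of the domain of `V` into
consecutive pieces `D n` covering the domain, with `V_n = V ↾ D n`), such that
(1) every interval of the domain on which `V` is pure is contained in `⋃_{n ≤ m} D n` for
some `m`; and
(2) for each `n` there is `j_n ∈ ω` such that the number of positions in `D n` whose letter
has second subscript `j_n` strictly exceeds the total number of such positions in all the
other pieces.
Then `[[V]] ≠ [[E]]` in the cone group `𝒞_κ`. -/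
theorem coneClass_ne_one_of_omega_concat
    (ι : Type) (V : Word ι) (hV : V.Reduced)
    (D : ℕ → Set ℚ)
    (hcover : V.dom = ⋃ n, D n)
    (horder : ∀ m n : ℕ, m < n → ∀ a ∈ D m, ∀ b ∈ D n, a < b)
    (h1 : ∀ I : Set ℚ, V.IsIntervalIn I → (V.restrict I).IsPure →
      ∃ m : ℕ, I ⊆ ⋃ n ∈ Set.Iic m, D n)
    (h2 : ∀ n : ℕ, ∃ j : ℕ,
      {q | q ∈ D n ∧ (V.letter q).2.1 = j}.ncard >
        {q | q ∈ V.dom \ D n ∧ (V.letter q).2.1 = j}.ncard) :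
    coneClass V ≠ 1 := by
  intro hcon
  have hmem : (⟨V.Phi, Phi_mem_wordGroup V⟩ : wordGroup ι) ∈ Subgroup.normalClosure (pureClasses ι) :=
    (QuotientGroup.eq_one_iff _).1 hcon
  obtain ⟨r, hr⟩ := ConeProof.SS_of_mem _ hmem
  choose c hc using fun N => ConeProof.lev_of_SS V r N (hr N)
  exact ConeProof.main V hV D hcover horder h1 h2 r c hc
end
end
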